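/- arXiv:1609.07339 — 2 statements merged into one kernel-verified Lean document; each statement's English description precedes it below -/
import Mathlib

section
/- Let A be a random variable satisfying Assumption (A1) with parameters κ > 0 and h > 0, and let X be a random variable independent of A such that ∫₀^∞ y^{κ−1} |P(X > y) − P(AX > y)| dy < ∞. Then there exists a function q ∈ 𝒬(κ,h) such that for every continuity point x > 0 of q, lim_{n→∞} x^κ e^{κnh} P(X > x e^{nh}) = q(x). -/
open MeasureTheory ProbabilityTheory Filter Topology

noncomputable section

/-- `q ∈ 𝒬(κ,h)`: `q : (0,∞) → [0,∞)`, `x ↦ x^{-κ} q(x)` is nonincreasing on `(0,∞)`,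
and `q(x e^h) = q(x)` for all `x > 0`. -/
def MemQ (κ h : ℝ) (q : ℝ → ℝ) : Prop :=
  (∀ x : ℝ, 0 < x → 0 ≤ q x) ∧
  AntitoneOn (fun x : ℝ => x ^ (-κ) * q x) (Set.Ioi (0 : ℝ)) ∧
  (∀ x : ℝ, 0 < x → q (x * Real.exp h) = q x)

/-- The conditional distribution of `log A` given `A ≠ 0` is arithmetic with span `h`:
given `A ≠ 0`, `log A ∈ hℤ` a.s., and `h` is the largest positive number with this property. -/
def CondLogArithSpan {Ω : Type*} [MeasurableSpace Ω] (P : Measure Ω) (A : Ω → ℝ)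
    (h : ℝ) : Prop :=
  0 < h ∧
  P {ω | A ω ≠ 0 ∧ ∀ k : ℤ, Real.log (A ω) ≠ (k : ℝ) * h} = 0 ∧
  ∀ h' : ℝ, 0 < h' →
    P {ω | A ω ≠ 0 ∧ ∀ k : ℤ, Real.log (A ω) ≠ (k : ℝ) * h'} = 0 → h' ≤ h

/-- Assumption (A1): `A ≥ 0` a.s., `E A^κ = 1`, `E[A^κ log₊ A] < ∞`, and `log A`
conditioned on `A ≠ 0` is arithmetic with span `h`. -/
def AssumptionA1 {Ω : Type*} [MeasurableSpace Ω] (P : Measure Ω) (A : Ω → ℝ)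
    (κ h : ℝ) : Prop :=
  0 < κ ∧ (∀ᵐ ω ∂P, 0 ≤ A ω) ∧ (∫ ω, A ω ^ κ ∂P) = 1 ∧
  (∫⁻ ω, ENNReal.ofReal (A ω ^ κ * max (Real.log (A ω)) 0) ∂P) < ⊤ ∧
  CondLogArithSpan P A h

namespace ImplicitRenewal

/-- Convolution of two real sequences indexed by `ℤ`. -/
def conv (p w : ℤ → ℝ) (n : ℤ) : ℝ := ∑' k, p k * w (n - k)

theorem summable_mul_of_bounded {p v : ℤ → ℝ} (hp : Summable p) {B : ℝ} (hv : ∀ n, |v n| ≤ B)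
    (n : ℤ) : Summable fun k => p k * v (n - k) := by
  refine Summable.of_norm_bounded (hp.abs.mul_right B) fun k => ?_
  rw [Real.norm_eq_abs, abs_mul]
  exact mul_le_mul_of_nonneg_left (hv _) (abs_nonneg _)

/-- Dominated convergence for convolutions with a summable sequence. -/
theorem tendsto_conv {ι : Type*} {l : Filter ι} {p v : ℤ → ℝ} {F : ι → ℤ → ℝ}
    (hp : Summable p) {B : ℝ} (hF : ∀ i n, |F i n| ≤ B) (n : ι → ℤ)
    (hlim : ∀ k, Tendsto (fun i => F i (n i - k)) l (𝓝 (v k))) :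
    Tendsto (fun i => conv p (F i) (n i)) l (𝓝 (∑' k, p k * v k)) := by
  refine tendsto_tsum_of_dominated_convergence (hp.abs.mul_right B)
    (fun k => (hlim k).const_mul _) (Eventually.of_forall fun i k => ?_)
  rw [Real.norm_eq_abs, abs_mul]
  exact mul_le_mul_of_nonneg_left (hF _ _) (abs_nonneg _)

theorem exists_forall_le_of_tendsto_cofinite {s : ℤ → ℝ} (hs : Tendsto s cofinite (𝓝 0))
    {n : ℤ} (hn : 0 < s n) : ∃ m, ∀ k, s k ≤ s m := by
  have hfin : {k | ¬ s k < s n}.Finite := hs.eventually (gt_mem_nhds hn)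
  obtain ⟨m, hm, hmax⟩ := hfin.exists_maximalFor s _ ⟨n, by simp⟩
  refine ⟨m, fun k => ?_⟩
  by_contra! hk
  have : ¬ s k < s n := fun h => hm (hk.trans h)
  exact absurd (hmax this hk.le) (not_le.2 hk)

/-- Maximum principle, relative to a positive superharmonic weight `w`. -/
theorem le_of_subharmonic {p w D : ℤ → ℝ} {E : Set ℤ} {a : ℤ} {M : ℝ} (hp : ∀ k, 0 ≤ p k)
    (ha : a ≠ 0) (hpa : 0 < p a) (hw : ∀ n, 0 < w n)
    (hws : ∀ n, Summable fun k => p k * w (n - k)) (hpw : ∀ n, conv p w n ≤ w n)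
    (hDs : ∀ n, Summable fun k => p k * D (n - k))
    (hlim : Tendsto (fun n => D n / w n) cofinite (𝓝 0)) (hM : 0 ≤ M)
    (hD : ∀ n ∉ E, D n ≤ conv p D n) (hE : ∀ n ∈ E, D n ≤ M * w n) (n : ℤ) :
    D n ≤ M * w n := by
  by_contra! hn
  have hsn : M < D n / w n := (lt_div_iff₀ (hw n)).2 hn
  obtain ⟨m, hm⟩ := exists_forall_le_of_tendsto_cofinite hlim (hM.trans_lt hsn)
  set t := D m / w m with ht
  have hMt : M < t := hsn.trans_le (hm n)
  have hle : ∀ k, D k ≤ t * w k := fun k => (div_le_iff₀ (hw k)).1 (hm k)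
  have hstep : ∀ k, D k = t * w k → D (k - a) = t * w (k - a) := by
    intro k hk
    have hkE : k ∉ E := fun h => by
      have := hE k h
      have := mul_lt_mul_of_pos_right hMt (hw k)
      linarith
    have hsum : Summable fun j => p j * (t * w (k - j) - D (k - j)) := by
      refine (((hws k).mul_left t).sub (hDs k)).congr fun j => by ring
    have heq : ∑' j, p j * (t * w (k - j) - D (k - j)) = t * conv p w k - conv p D k := by
      rw [conv, conv, ← tsum_mul_left, ← ((hws k).mul_left t).tsum_sub (hDs k)]
      exact tsum_congr fun j => by ring
    have hnn : ∀ j, 0 ≤ p j * (t * w (k - j) - D (k - j)) := fun j =>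
      mul_nonneg (hp j) (sub_nonneg.2 (hle _))
    have h1 := hsum.le_tsum a fun j _ => hnn j
    have h2 : t * conv p w k ≤ t * w k := mul_le_mul_of_nonneg_left (hpw k) (by linarith)
    have h3 := hD k hkE
    have h4 : p a * (t * w (k - a) - D (k - a)) = 0 := le_antisymm (by linarith) (hnn a)
    rcases mul_eq_zero.1 h4 with h | h <;> linarith
  have hiter : ∀ j : ℕ, D (m - j * a) = t * w (m - j * a) := by
    intro j
    induction j with
    | zero => simp [ht, (hw m).ne']
    | succ j ih =>
      have := hstep _ ih
      rwa [show m - (j : ℤ) * a - a = m - ((j + 1 : ℕ) : ℤ) * a by push_cast; ring] at this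
  have hinj : Function.Injective fun j : ℕ => m - (j : ℤ) * a := by
    intro i j hij
    have : (i : ℤ) * a = j * a := by simpa using hij
    exact_mod_cast mul_right_cancel₀ ha this
  have h0 : Tendsto (fun _ : ℕ => t) cofinite (𝓝 0) := by
    refine (hlim.comp hinj.tendsto_cofinite).congr fun j => ?_
    simp only [Function.comp_apply, hiter j, mul_div_assoc, div_self (hw _).ne', mul_one]
  have := tendsto_nhds_unique h0 tendsto_const_nhds
  linarith

/-- Partial sums of the renewal sequence of `p`. -/
def renewalPartial (p : ℤ → ℝ) : ℕ → ℤ → ℝ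
  | 0 => 0
  | N + 1 => fun n => (if n = 0 then 1 else 0) + conv p (renewalPartial p N) n

section

variable {p : ℤ → ℝ}

theorem renewalPartial_succ (N : ℕ) (n : ℤ) : renewalPartial p (N + 1) n =
    (if n = 0 then 1 else 0) + conv p (renewalPartial p N) n := rfl

theorem renewalPartial_nonneg (hp : ∀ k, 0 ≤ p k) (N : ℕ) (n : ℤ) :
    0 ≤ renewalPartial p N n := by
  induction N generalizing n with
  | zero => simp [renewalPartial]
  | succ N ih =>
    rw [renewalPartial_succ]
    have : 0 ≤ conv p (renewalPartial p N) n := tsum_nonneg fun k => mul_nonneg (hp k) (ih _)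
    split_ifs <;> linarith

theorem conv_mono {v w : ℤ → ℝ} (hp : ∀ k, 0 ≤ p k) {n : ℤ}
    (hv : Summable fun k => p k * v (n - k)) (hw : Summable fun k => p k * w (n - k))
    (h : ∀ k, v k ≤ w k) : conv p v n ≤ conv p w n :=
  hv.tsum_le_tsum (fun k => mul_le_mul_of_nonneg_left (h _) (hp k)) hw

theorem conv_const (hp1 : ∑' k, p k = 1) (B : ℝ) (n : ℤ) : conv p (fun _ => B) n = B := by
  simp [conv, tsum_mul_right, hp1]

theorem abs_renewalPartial_le (hp : ∀ k, 0 ≤ p k) (hps : Summable p) (hp1 : ∑' k, p k = 1)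
    (N : ℕ) (n : ℤ) : |renewalPartial p N n| ≤ N := by
  induction N generalizing n with
  | zero => simp [renewalPartial]
  | succ N ih =>
    rw [abs_of_nonneg (renewalPartial_nonneg hp _ _), renewalPartial_succ]
    have : conv p (renewalPartial p N) n ≤ conv p (fun _ => (N : ℝ)) n :=
      conv_mono hp (summable_mul_of_bounded hps ih n) (hps.mul_right _)
        fun k => (le_abs_self _).trans (ih k)
    rw [conv_const hp1] at this
    push_cast
    split_ifs <;> linarith

theorem renewalPartial_mono (hp : ∀ k, 0 ≤ p k) (hps : Summable p) (hp1 : ∑' k, p k = 1)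
    (n : ℤ) : Monotone fun N => renewalPartial p N n := by
  refine monotone_nat_of_le_succ fun N => ?_
  induction N generalizing n with
  | zero => exact renewalPartial_nonneg hp 1 n
  | succ N ih =>
    simp only [renewalPartial_succ (N + 1) n, renewalPartial_succ N n]
    gcongr
    exact conv_mono hp (summable_mul_of_bounded hps (abs_renewalPartial_le hp hps hp1 _) n)
      (summable_mul_of_bounded hps (abs_renewalPartial_le hp hps hp1 _) n) ih

theorem tendsto_renewalPartial_cofinite (hp : ∀ k, 0 ≤ p k) (hps : Summable p)
    (hp1 : ∑' k, p k = 1) (N : ℕ) : Tendsto (renewalPartial p N) cofinite (𝓝 0) := by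
  induction N with
  | zero => exact tendsto_const_nhds
  | succ N ih =>
    have h1 : Tendsto (fun n : ℤ => if n = 0 then (1 : ℝ) else 0) cofinite (𝓝 0) :=
      tendsto_const_nhds.congr' <| by
        filter_upwards [(Set.finite_singleton (0 : ℤ)).compl_mem_cofinite] with n hn
        rw [if_neg (show n ≠ 0 from hn)]
    have h2 := tendsto_conv (v := fun _ => 0) hps
      (fun _ : ℤ => abs_renewalPartial_le hp hps hp1 N) id fun k =>
        ih.comp (sub_left_injective (b := k)).tendsto_cofinite
    simp only [mul_zero, tsum_zero] at h2
    have h3 := h1.add h2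
    rwa [add_zero] at h3

theorem renewalPartial_le_exp (hp : ∀ k, 0 ≤ p k) (hps : Summable p) (hp1 : ∑' k, p k = 1)
    {c ρ : ℝ} (hc : HasSum (fun k : ℤ => p k * Real.exp (-(c * k))) ρ) (hρ : ρ < 1)
    (N : ℕ) (n : ℤ) : renewalPartial p N n ≤ (1 - ρ)⁻¹ * Real.exp (c * n) := by
  have hpos : 0 < (1 - ρ)⁻¹ := inv_pos.2 (by linarith)
  induction N generalizing n with
  | zero => simp only [renewalPartial, Pi.zero_apply]; positivity
  | succ N ih =>
    have hw : HasSum (fun k : ℤ => p k * ((1 - ρ)⁻¹ * Real.exp (c * (n - k : ℤ))))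
        (ρ * ((1 - ρ)⁻¹ * Real.exp (c * n))) := by
      refine (hc.mul_right ((1 - ρ)⁻¹ * Real.exp (c * n))).congr_fun ?_
      intro k
      rw [show c * ((n - k : ℤ) : ℝ) = -(c * k) + c * n by push_cast; ring, Real.exp_add]
      ring
    have h1 := conv_mono (w := fun k : ℤ => (1 - ρ)⁻¹ * Real.exp (c * k)) hp
      (summable_mul_of_bounded hps (abs_renewalPartial_le hp hps hp1 N) n) hw.summable ih
    rw [show conv p (fun k : ℤ => (1 - ρ)⁻¹ * Real.exp (c * k)) n = _ from hw.tsum_eq] at h1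
    have h2 : (if n = 0 then (1 : ℝ) else 0) ≤ Real.exp (c * n) := by
      split_ifs with h
      · simp [h]
      · positivity
    have h3 : (1 - ρ)⁻¹ * Real.exp (c * n) =
        Real.exp (c * n) + ρ * ((1 - ρ)⁻¹ * Real.exp (c * n)) := by
      have : 1 - ρ ≠ 0 := by linarith
      field_simp
      ring
    rw [renewalPartial_succ]
    linarith

/-- Existence of a bounded renewal sequence that vanishes at `-∞`. -/
theorem exists_renewal (hp : ∀ k, 0 ≤ p k) (hps : Summable p) (hp1 : ∑' k, p k = 1)
    {a : ℤ} (ha : a ≠ 0) (hpa : 0 < p a)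
    {c ρ : ℝ} (hc0 : 0 < c) (hc : HasSum (fun k : ℤ => p k * Real.exp (-(c * k))) ρ)
    (hρ : ρ < 1) :
    ∃ (u : ℤ → ℝ) (B : ℝ), (∀ n, |u n| ≤ B) ∧
      (∀ n, u n = (if n = 0 then 1 else 0) + conv p u n) ∧ Tendsto u atBot (𝓝 0) := by
  have habs := abs_renewalPartial_le hp hps hp1
  have hle : ∀ N n, renewalPartial p N n ≤ (1 - ρ)⁻¹ := fun N n => by
    have h0 : renewalPartial p N 0 ≤ (1 - ρ)⁻¹ := by
      simpa using renewalPartial_le_exp hp hps hp1 hc hρ N 0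
    have := le_of_subharmonic (w := fun _ => 1) (E := {0}) (D := renewalPartial p N)
      hp ha hpa (by simp) (by simpa using hps) (fun n => (conv_const hp1 1 n).le)
      (summable_mul_of_bounded hps (habs N))
      (by simpa using tendsto_renewalPartial_cofinite hp hps hp1 N)
      (renewalPartial_nonneg hp N 0)
      (fun k hk => by
        have h := renewalPartial_mono hp hps hp1 k N.le_succ
        simp only [Nat.succ_eq_add_one, renewalPartial_succ] at h
        simpa [show k ≠ 0 from hk] using h)
      (by simp) n
    linarith
  have hlim : ∀ n, Tendsto (fun N => renewalPartial p N n) atTop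
      (𝓝 (⨆ N, renewalPartial p N n)) := fun n =>
    tendsto_atTop_ciSup (renewalPartial_mono hp hps hp1 n)
      ⟨(1 - ρ)⁻¹, by rintro _ ⟨N, rfl⟩; exact hle N n⟩
  have hnn : ∀ n, 0 ≤ ⨆ N, renewalPartial p N n := fun n =>
    ge_of_tendsto' (hlim n) fun N => renewalPartial_nonneg hp N n
  refine ⟨fun n => ⨆ N, renewalPartial p N n, (1 - ρ)⁻¹, fun n => ?_, fun n => ?_, ?_⟩
  · rw [abs_of_nonneg (hnn n)]
    exact le_of_tendsto' (hlim n) fun N => hle N n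
  · have h1 : Tendsto (fun N => renewalPartial p (N + 1) n) atTop
        (𝓝 (⨆ N, renewalPartial p N n)) := (hlim n).comp (tendsto_add_atTop_nat 1)
    refine tendsto_nhds_unique h1 (tendsto_const_nhds.add ?_)
    exact tendsto_conv hps (fun N k => by
      rw [abs_of_nonneg (renewalPartial_nonneg hp N k)]; exact hle N k) (fun _ => n)
      fun k => hlim (n - k)
  · refine tendsto_of_tendsto_of_tendsto_of_le_of_le (h := fun n : ℤ => (1 - ρ)⁻¹ * Real.exp (c * n))
      tendsto_const_nhds ?_ hnn fun n => le_of_tendsto' (hlim n) fun N =>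
        renewalPartial_le_exp hp hps hp1 hc hρ N n
    have : Tendsto (fun n : ℤ => c * (n : ℝ)) atBot atBot :=
      (tendsto_intCast_atBot_iff.2 tendsto_id).const_mul_atBot hc0
    simpa using (Real.tendsto_exp_atBot.comp this).const_mul (1 - ρ)⁻¹

end

/-- If `S` generates `ℤ` as a group and has a positive element, then the additive monoid generated
by `S` contains all large integers. -/
theorem exists_forall_ge_mem_closure {S : Set ℤ} (hS : AddSubgroup.closure S = ⊤) {b : ℤ}
    (hb : b ∈ S) (hb0 : 0 < b) : ∃ N₀ : ℤ, ∀ N ≥ N₀, N ∈ AddSubmonoid.closure S := by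
  have h1 : (1 : ℤ) ∈ (AddSubgroup.closure S).toAddSubmonoid := by rw [hS]; trivial
  rw [AddSubgroup.closure_toAddSubmonoid, AddSubmonoid.closure_union, AddSubmonoid.mem_sup] at h1
  obtain ⟨x, hx, y, hy, hxy⟩ := h1
  rw [AddSubmonoid.closure_neg, AddSubmonoid.mem_neg] at hy
  have hbc : b ∈ AddSubmonoid.closure S := AddSubmonoid.subset_closure hb
  obtain ⟨s, hs0, hs, hs1⟩ : ∃ s : ℤ, 0 < s ∧ s ∈ AddSubmonoid.closure S ∧
      s + 1 ∈ AddSubmonoid.closure S := by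
    have hm := AddSubmonoid.nsmul_mem _ hbc (y.natAbs + 1)
    refine ⟨-y + (y.natAbs + 1) • b, ?_, add_mem hy hm, ?_⟩
    · rw [nsmul_eq_mul]
      push_cast
      have : y ≤ |y| := le_abs_self y
      nlinarith [abs_nonneg y]
    · rw [show -y + (y.natAbs + 1) • b + 1 = x + (y.natAbs + 1) • b by linarith]
      exact add_mem hx hm
  refine ⟨s * s, fun N hN => ?_⟩
  have hr0 := Int.emod_nonneg N hs0.ne'
  have hrs := Int.emod_lt_of_pos N hs0
  have hq : s ≤ N / s := (Int.le_ediv_iff_mul_le hs0).2 hN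
  have hdm := Int.mul_ediv_add_emod N s
  obtain ⟨i, hi⟩ := Int.eq_ofNat_of_zero_le (show 0 ≤ N / s - N % s by linarith)
  obtain ⟨j, hj⟩ := Int.eq_ofNat_of_zero_le hr0
  have : N = i • s + j • (s + 1) := by
    rw [nsmul_eq_mul, nsmul_eq_mul, ← hi, ← hj]
    linarith
  rw [this]
  exact add_mem (AddSubmonoid.nsmul_mem _ hs _) (AddSubmonoid.nsmul_mem _ hs1 _)

/-- The upper limit of a bounded sequence that is eventually `p`-harmonic is determined by the limit
of its convolution with a summable sequence. -/
theorem exists_eventually_lt_and_mul_eq {p g u : ℤ → ℝ} {B c : ℝ} (hp : ∀ k, 0 ≤ p k)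
    (hps : Summable p) (hp1 : ∑' k, p k = 1)
    (hcl : AddSubgroup.closure {k | 0 < p k} = ⊤) {b : ℤ} (hb : 0 < b) (hpb : 0 < p b)
    (hg : Summable g) (hu : ∀ n, |u n| ≤ B) (hhar : ∀ n, 0 < n → u n = conv p u n)
    (hgu : Tendsto (conv g u) atTop (𝓝 c)) :
    ∃ L, (∀ ε > 0, ∀ᶠ n in atTop, u n < L + ε) ∧ L * ∑' k, g k = c := by
  have hbdd : IsBoundedUnder (· ≤ ·) atTop u :=
    isBoundedUnder_of ⟨B, fun n => (abs_le.1 (hu n)).2⟩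
  have hbdd' : IsBoundedUnder (· ≥ ·) atTop u :=
    isBoundedUnder_of ⟨-B, fun n => (abs_le.1 (hu n)).1⟩
  set L := limsup u atTop with hL
  have hlt : ∀ ε > 0, ∀ᶠ n in atTop, u n < L + ε := fun ε hε =>
    eventually_lt_of_limsup_lt (by linarith) hbdd
  refine ⟨L, hlt, ?_⟩
  have hclust : MapClusterPt L atTop u := by
    refine (Metric.nhds_basis_ball.mapClusterPt_iff_frequently).2 fun ε hε => ?_
    have hfr : ∃ᶠ n in atTop, L - ε < u n :=
      frequently_lt_of_lt_limsup hbdd'.isCoboundedUnder_le (by linarith)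
    refine (hfr.and_eventually (hlt ε hε)).mono fun n hn => ?_
    rw [Metric.mem_ball, Real.dist_eq, abs_lt]
    constructor <;> linarith
  obtain ⟨U, hU, hUL⟩ := mapClusterPt_iff_ultrafilter.1 hclust
  have hlim : ∀ k : ℤ, ∃ y, Tendsto (fun n => u (n + k)) U (𝓝 y) := fun k => by
    obtain ⟨y, -, hy⟩ := (isCompact_Icc (a := -B) (b := B)).ultrafilter_le_nhds'
      (U.map fun n => u (n + k)) (Ultrafilter.mem_map.2 (univ_mem' (f := (U : Filter ℤ)) fun n => abs_le.1 (hu (n + k))))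
    exact ⟨y, hy⟩
  choose v hv using hlim
  have htop : ∀ k : ℤ, Tendsto (fun n : ℤ => n + k) U atTop := fun k =>
    (tendsto_atTop_add_const_right atTop k tendsto_id).mono_left hU
  have hvL : ∀ k, v k ≤ L := fun k => le_of_forall_pos_le_add fun ε hε =>
    le_of_tendsto (hv k) (((htop k).eventually (hlt ε hε)).mono fun n hn => hn.le)
  have hv0 : v 0 = L := tendsto_nhds_unique (hv 0) (by simpa using hUL)
  have hconv : ∀ {w : ℤ → ℝ}, Summable w → ∀ k,
      Tendsto (fun n => conv w u (n + k)) U (𝓝 (conv w v k)) := fun {w} hw k =>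
    tendsto_conv hw (fun _ => hu) _ fun j => by simpa only [add_sub_assoc] using hv (k - j)
  have hvB : ∀ k, |v k| ≤ B := fun k =>
    le_of_tendsto' (hv k).abs fun n => hu _
  have hvp : ∀ k, v k = conv p v k := fun k => by
    refine tendsto_nhds_unique ((hv k).congr' ?_) (hconv hps k)
    filter_upwards [(htop k).eventually (eventually_gt_atTop 0)] with n hn using hhar _ hn
  have hstep : ∀ a, 0 < p a → ∀ k, v k = L → v (k - a) = L := by
    intro a ha k hk
    have hs := summable_mul_of_bounded hps hvB k
    have hsum : Summable fun j => p j * (L - v (k - j)) :=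
      ((hps.mul_right L).sub hs).congr fun j => by ring
    have heq : ∑' j, p j * (L - v (k - j)) = 0 := by
      have : ∑' j, p j * (L - v (k - j)) = ∑' j, p j * L - conv p v k := by
        rw [conv, ← (hps.mul_right L).tsum_sub hs]
        exact tsum_congr fun j => by ring
      rw [this, tsum_mul_right, hp1, ← hvp, hk]
      ring
    have hnn : ∀ j, 0 ≤ p j * (L - v (k - j)) := fun j =>
      mul_nonneg (hp j) (sub_nonneg.2 (hvL _))
    have h1 := hsum.le_tsum a fun j _ => hnn j
    have h4 : p a * (L - v (k - a)) = 0 := le_antisymm (by linarith) (hnn a)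
    rcases mul_eq_zero.1 h4 with h | h <;> linarith
  have hclos : ∀ N ∈ AddSubmonoid.closure {k | 0 < p k}, ∀ k, v k = L → v (k - N) = L := by
    intro N hN
    induction hN using AddSubmonoid.closure_induction with
    | mem a ha => exact hstep a ha
    | zero => simp
    | add x y _ _ hx hy =>
      intro k hk
      rw [← sub_sub]
      exact hy _ (hx k hk)
  obtain ⟨N₀, hN₀⟩ := exists_forall_ge_mem_closure hcl (b := b) hpb hb
  have hvbot : Tendsto v atBot (𝓝 L) := tendsto_const_nhds.congr' <| by
    filter_upwards [eventually_le_atBot (-N₀)] with m hm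
    have := hclos (-m) (hN₀ _ (by linarith)) 0 hv0
    simpa using this.symm
  have hgv : ∀ m, conv g v m = c := fun m =>
    tendsto_nhds_unique (hconv hg m) (hgu.comp (htop m))
  have hgL : Tendsto (conv g v) atBot (𝓝 (∑' k, g k * L)) :=
    tendsto_conv hg (fun _ => hvB) id fun k =>
      hvbot.comp (tendsto_atBot_add_const_right atBot (-k) tendsto_id)
  rw [mul_comm, ← tsum_mul_right]
  exact tendsto_nhds_unique hgL (tendsto_const_nhds.congr fun m => (hgv m).symm)

/-- The sign with which mass at `j` contributes to the two-sided tail at `k`. -/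
def tailSign (j k : ℤ) : ℝ := if 0 ≤ k ∧ k < j then 1 else if j ≤ k ∧ k < 0 then -1 else 0

theorem tailSign_sub (j k : ℤ) : tailSign j k - tailSign j (k - 1) =
    (if k = 0 then 1 else 0) - (if k = j then 1 else 0) := by
  unfold tailSign
  split_ifs <;> first | omega | norm_num

theorem hasSum_abs_tailSign (j : ℤ) : HasSum (fun k => |tailSign j k|) |(j : ℝ)| := by
  have h : ∀ k, |tailSign j k| = if k ∈ Finset.Ico 0 j ∪ Finset.Ico j 0 then 1 else 0 := by
    intro k
    simp only [Finset.mem_union, Finset.mem_Ico, tailSign]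
    split_ifs <;> first | omega | norm_num
  have hcard : ((Finset.Ico 0 j ∪ Finset.Ico j 0).card : ℝ) = |(j : ℝ)| := by
    rcases le_total 0 j with hj | hj
    · rw [Finset.Ico_eq_empty (a := j) (by omega), Finset.union_empty, Int.card_Ico,
        abs_of_nonneg (by exact_mod_cast hj)]
      exact_mod_cast (by omega : (((j - 0).toNat : ℕ) : ℤ) = j)
    · rw [Finset.Ico_eq_empty (b := j) (by omega), Finset.empty_union, Int.card_Ico,
        abs_of_nonpos (by exact_mod_cast hj)]
      exact_mod_cast (by omega : (((0 - j).toNat : ℕ) : ℤ) = -j)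
  rw [← hcard]
  have : HasSum (fun k => |tailSign j k|)
      (∑ k ∈ Finset.Ico 0 j ∪ Finset.Ico j 0, |tailSign j k|) :=
    hasSum_sum_of_ne_finset_zero fun k hk => by rw [h, if_neg hk]
  rwa [Finset.sum_congr rfl fun k hk => by rw [h, if_pos hk], Finset.sum_const, nsmul_eq_mul,
    mul_one] at this

/-- The two-sided tail sequence of a law with finite first moment. -/
theorem exists_summable_sub_eq {p : ℤ → ℝ} (hp : ∀ k, 0 ≤ p k) (hps : Summable p)
    (hp1 : ∑' k, p k = 1) (hmom : Summable fun k : ℤ => p k * |(k : ℝ)|) :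
    ∃ g : ℤ → ℝ, Summable g ∧ ∀ k, g k - g (k - 1) = (if k = 0 then 1 else 0) - p k := by
  have hF : Summable fun x : ℤ × ℤ => p x.1 * tailSign x.1 x.2 := by
    refine Summable.of_norm ?_
    refine (summable_prod_of_nonneg fun _ => norm_nonneg _).2 ⟨fun j => ?_, hmom.congr fun j => ?_⟩
    · simp only [norm_mul, Real.norm_eq_abs]
      exact (hasSum_abs_tailSign j).summable.mul_left _
    · simp only [norm_mul, Real.norm_eq_abs, tsum_mul_left, (hasSum_abs_tailSign j).tsum_eq,
        abs_of_nonneg (hp j)]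
  have hF' := hF.prod_symm
  refine ⟨fun k => ∑' j, p j * tailSign j k, hF'.prod, fun k => ?_⟩
  have hs : ∀ k, Summable fun j => p j * tailSign j k := hF'.prod_factor
  simp only
  rw [← (hs k).tsum_sub (hs (k - 1))]
  simp only [← mul_sub, tailSign_sub]
  simp only [mul_sub]
  rw [(hps.mul_right _).tsum_sub, tsum_mul_right, hp1, one_mul]
  · simp
  · exact summable_of_ne_finset_zero (s := {k}) fun j hj => by
      rw [if_neg (fun h => hj (by simp [h])), mul_zero]

/-- The renewal theorem on `ℤ` for an aperiodic law with finite first moment and an exponential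
moment smaller than one on the left. -/
theorem exists_renewal_tendsto {p : ℤ → ℝ} (hp : ∀ k, 0 ≤ p k) (hps : Summable p)
    (hp1 : ∑' k, p k = 1) (hmom : Summable fun k : ℤ => p k * |(k : ℝ)|)
    (hcl : AddSubgroup.closure {k | 0 < p k} = ⊤) {b : ℤ} (hb : 0 < b) (hpb : 0 < p b)
    {c ρ : ℝ} (hc0 : 0 < c) (hc : HasSum (fun k : ℤ => p k * Real.exp (-(c * k))) ρ)
    (hρ : ρ < 1) :
    ∃ (u : ℤ → ℝ) (B ℓ : ℝ), (∀ n, |u n| ≤ B) ∧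
      (∀ n, u n = (if n = 0 then 1 else 0) + conv p u n) ∧ Tendsto u atBot (𝓝 0) ∧
      Tendsto u atTop (𝓝 ℓ) := by
  obtain ⟨u, B, hB, hu, hbot⟩ := exists_renewal hp hps hp1 hb.ne' hpb hc0 hc hρ
  obtain ⟨g, hg, hgp⟩ := exists_summable_sub_eq hp hps hp1 hmom
  have hdiff : ∀ n, conv g u n = conv g u (n - 1) + if n = 0 then 1 else 0 := by
    intro n
    have hs : Summable fun k => g (k - 1) := hg.comp_injective sub_left_injective
    have h1 : conv g u (n - 1) = conv (fun k => g (k - 1)) u n := by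
      rw [conv, ← (Equiv.subRight (1 : ℤ)).tsum_eq]
      refine tsum_congr fun k => ?_
      simp only [Equiv.subRight_apply]
      congr 2
      ring
    have h2 : conv g u n - conv (fun k => g (k - 1)) u n =
        ∑' k, ((if k = 0 then 1 else 0) - p k) * u (n - k) := by
      rw [conv, conv, ← (summable_mul_of_bounded hg hB n).tsum_sub
        (summable_mul_of_bounded hs hB n)]
      exact tsum_congr fun k => by rw [← hgp]; ring
    have hδ : ∀ k : ℤ, k ≠ 0 → (if k = 0 then (1 : ℝ) else 0) * u (n - k) = 0 := fun k hk => by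
      simp [hk]
    have h3 : ∑' k, ((if k = 0 then 1 else 0) - p k) * u (n - k) = u n - conv p u n := by
      simp only [sub_mul]
      rw [Summable.tsum_sub _ (summable_mul_of_bounded hps hB n), tsum_eq_single 0 hδ]
      · simp [conv]
      · exact summable_of_ne_finset_zero (s := {0}) fun k hk => hδ k (by simpa using hk)
    have := hu n
    linarith
  have hgbot : Tendsto (conv g u) atBot (𝓝 0) := by
    simpa using tendsto_conv (v := fun _ => 0) hg (fun _ : ℤ => hB) id fun k =>
      hbot.comp (tendsto_atBot_add_const_right atBot (-k) tendsto_id)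
  have hneg : ∀ n : ℤ, n < 0 → conv g u n = 0 := by
    intro n hn
    have hconst : ∀ j : ℕ, conv g u (n - j) = conv g u n := by
      intro j
      induction j with
      | zero => simp
      | succ j ih =>
        have := hdiff (n - j)
        rw [if_neg (by omega), ih, add_zero] at this
        rw [this]
        congr 1
        push_cast
        ring
    have hlim : Tendsto (fun j : ℕ => n - (j : ℤ)) atTop atBot :=
      tendsto_atBot.2 fun m => by
        filter_upwards [eventually_ge_atTop (n - m).toNat] with j hj
        omega
    exact tendsto_nhds_unique (tendsto_const_nhds.congr fun j => (hconst j).symm)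
      (hgbot.comp hlim)
  have hpos : ∀ j : ℕ, conv g u j = 1 := by
    intro j
    induction j with
    | zero => simpa [hneg (-1) (by norm_num)] using hdiff 0
    | succ j ih =>
      rw [hdiff, if_neg (by omega), add_zero, ← ih]
      congr 1
      push_cast
      ring
  have hgtop : Tendsto (conv g u) atTop (𝓝 1) := tendsto_const_nhds.congr' <| by
    filter_upwards [eventually_ge_atTop 0] with n hn
    lift n to ℕ using hn
    exact (hpos n).symm
  have hhar : ∀ n, 0 < n → u n = conv p u n := fun n hn => by
    simpa [hn.ne'] using hu n
  have hcneg : ∀ (w : ℤ → ℝ) n, conv w (fun k => -u k) n = -conv w u n := fun w n => by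
    simp only [conv, mul_neg, tsum_neg]
  obtain ⟨L, hL, hLg⟩ := exists_eventually_lt_and_mul_eq hp hps hp1 hcl hb hpb hg hB hhar hgtop
  obtain ⟨L', hL', hLg'⟩ := exists_eventually_lt_and_mul_eq (u := fun k => -u k) hp hps hp1 hcl hb
    hpb hg (fun n => by rw [abs_neg]; exact hB n) (fun n hn => by rw [hcneg, ← hhar n hn])
    (hgtop.neg.congr fun n => (hcneg g n).symm)
  have hLL : L' = -L := by
    have hG : ∑' k, g k ≠ 0 := fun h => by simp [h] at hLg
    exact mul_right_cancel₀ hG (by linarith)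
  refine ⟨u, B, L, hB, hu, hbot, Metric.tendsto_nhds.2 fun ε hε => ?_⟩
  filter_upwards [hL ε hε, hL' ε hε] with n h1 h2
  rw [Real.dist_eq, abs_lt]
  constructor <;> linarith

/-- Asymptotics of solutions of the renewal equation `f = p * f + ψ`. -/
theorem exists_tendsto_of_renewal_equation {p f ψ w u : ℤ → ℝ} {B ℓ : ℝ} (hp : ∀ k, 0 ≤ p k)
    (hps : Summable p) {a : ℤ} (ha : a ≠ 0) (hpa : 0 < p a)
    (huB : ∀ n, |u n| ≤ B) (hu : ∀ n, u n = (if n = 0 then 1 else 0) + conv p u n)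
    (hubot : Tendsto u atBot (𝓝 0)) (hutop : Tendsto u atTop (𝓝 ℓ))
    (hw : ∀ n, 1 ≤ w n) (hws : ∀ n, Summable fun k => p k * w (n - k))
    (hpw : ∀ n, conv p w n ≤ w n) (hwtop : Tendsto w atTop atTop)
    (hfs : ∀ n, Summable fun k => p k * f (n - k))
    (hfbot : Tendsto f atBot (𝓝 0)) (hftop : Tendsto (fun n => f n / w n) atTop (𝓝 0))
    (hψ : Summable ψ) (hf : ∀ n, f n = conv p f n + ψ n) :
    ∃ l, Tendsto f atTop (𝓝 l) := by
  have hr_bot : Tendsto (conv ψ u) atBot (𝓝 0) := by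
    simpa using tendsto_conv (v := fun _ => 0) hψ (fun _ : ℤ => huB) id fun k =>
      hubot.comp (tendsto_atBot_add_const_right atBot (-k) tendsto_id)
  have hr_top : Tendsto (conv ψ u) atTop (𝓝 (∑' k, ψ k * ℓ)) :=
    tendsto_conv hψ (fun _ : ℤ => huB) id fun k =>
      hutop.comp (tendsto_atTop_add_const_right atTop (-k) tendsto_id)
  have hr_le : ∀ n, |conv ψ u n| ≤ ∑' k, |ψ k| * B := fun n => by
    rw [← Real.norm_eq_abs]
    refine tsum_of_norm_bounded (hψ.abs.mul_right B).hasSum fun k => ?_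
    rw [Real.norm_eq_abs, abs_mul]
    exact mul_le_mul_of_nonneg_left (huB _) (abs_nonneg _)
  have hr : ∀ n, conv ψ u n = conv p (conv ψ u) n + ψ n := by
    intro n
    have hprod : Summable (Function.uncurry fun k j => p k * (ψ j * u (n - k - j))) := by
      refine Summable.of_norm_bounded ((hps.abs.mul_of_nonneg (hψ.abs.mul_right B)
        (fun _ => abs_nonneg _) fun k => mul_nonneg (abs_nonneg _)
          ((abs_nonneg _).trans (huB 0)))) fun x => ?_
      rw [Function.uncurry, Real.norm_eq_abs, abs_mul, abs_mul]
      gcongr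
      exact huB _
    have h1 : conv p (conv ψ u) n = ∑' j, ψ j * conv p u (n - j) := by
      simp only [conv, ← tsum_mul_left]
      rw [← hprod.tsum_comm]
      refine tsum_congr fun j => tsum_congr fun k => ?_
      rw [sub_right_comm]
      ring
    have hδ : ∀ j : ℤ, j ≠ n → ψ j * (if n - j = 0 then (1 : ℝ) else 0) = 0 := fun j hj => by
      rw [if_neg (by omega), mul_zero]
    have h2 : ∑' j, ψ j * conv p u (n - j) =
        conv ψ u n - ∑' j, ψ j * (if n - j = 0 then (1 : ℝ) else 0) := by
      rw [conv, ← (summable_mul_of_bounded hψ huB n).tsum_sub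
        (summable_of_ne_finset_zero (s := {n}) fun j hj => hδ j (by simpa using hj))]
      refine tsum_congr fun j => ?_
      rw [hu (n - j)]
      ring
    rw [h1, h2, tsum_eq_single n hδ]
    simp
  have hwpos : ∀ n, 0 < w n := fun n => one_pos.trans_le (hw n)
  have hbot : Tendsto (fun n => (f n - conv ψ u n) / w n) atBot (𝓝 0) := by
    refine squeeze_zero_norm (fun n => ?_) (by simpa using (hfbot.sub hr_bot).norm)
    rw [norm_div, Real.norm_of_nonneg (hwpos n).le]
    exact div_le_self (norm_nonneg _) (hw n)
  have htop : Tendsto (fun n => (f n - conv ψ u n) / w n) atTop (𝓝 0) := by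
    simpa [sub_div] using hftop.sub (hr_top.div_atTop hwtop)
  have hcof : Tendsto (fun n => (f n - conv ψ u n) / w n) cofinite (𝓝 0) := by
    rw [Int.cofinite_eq]
    exact hbot.sup htop
  have hrs := summable_mul_of_bounded hps hr_le
  have hds : ∀ n, Summable fun k => p k * (f (n - k) - conv ψ u (n - k)) := fun n =>
    ((hfs n).sub (hrs n)).congr fun k => by ring
  have hd : ∀ n, conv p (fun k => f k - conv ψ u k) n = f n - conv ψ u n := by
    intro n
    have : conv p (fun k => f k - conv ψ u k) n = conv p f n - conv p (conv ψ u) n := by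
      simp only [conv, mul_sub]
      exact (hfs n).tsum_sub (hrs n)
    rw [this, hf n, hr n]
    ring
  have hle := le_of_subharmonic (E := ∅) (D := fun n => f n - conv ψ u n) hp ha hpa hwpos hws hpw hds hcof le_rfl
    (fun n _ => (hd n).ge) (by simp)
  have hge := le_of_subharmonic (E := ∅) (D := fun n => -(f n - conv ψ u n)) hp ha hpa hwpos hws
    hpw (fun n => by simpa only [mul_neg] using (hds n).neg)
    (by simpa only [neg_div, neg_zero] using hcof.neg) le_rfl
    (fun n _ => by rw [← hd n]; simp only [conv, mul_neg, tsum_neg]; exact le_rfl) (by simp)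
  refine ⟨_, hr_top.congr fun n => ?_⟩
  have h1 := hle n
  have h2 := hge n
  simp only [zero_mul] at h1 h2
  linarith

theorem limsup_const_mul_of_pos {S : ℕ → ℝ} {c : ℝ} (hc : 0 < c)
    (hb : IsBoundedUnder (· ≤ ·) atTop S) (hb' : IsBoundedUnder (· ≥ ·) atTop S) :
    limsup (fun n => c * S n) atTop = c * limsup S atTop :=
  (Monotone.map_limsup_of_continuousAt (f := fun y => c * y)
    (fun _ _ hxy => mul_le_mul_of_nonneg_left hxy hc.le) S (by fun_prop) hb
    hb'.isCoboundedUnder_le).symm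

/-- A nonincreasing function whose rescalings converge on a dense set of points has rescalings
converging to a function in `𝒬(κ,h)` at its continuity points. -/
theorem exists_memQ_of_dense_tendsto {T : ℝ → ℝ} (hT : Antitone T) (hT0 : ∀ y, 0 ≤ T y)
    {κ h : ℝ}
    (hdense : ∀ b c : ℝ, 0 < b → b < c → ∃ y ∈ Set.Ioo b c, ∃ l,
      Tendsto (fun n : ℕ => y ^ κ * Real.exp (κ * (n * h)) * T (y * Real.exp (n * h)))
        atTop (𝓝 l)) :
    ∃ q : ℝ → ℝ, MemQ κ h q ∧ ∀ x : ℝ, 0 < x → ContinuousAt q x →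
      Tendsto (fun n : ℕ => x ^ κ * Real.exp (κ * (n * h)) * T (x * Real.exp (n * h)))
        atTop (𝓝 (q x)) := by
  set S : ℝ → ℕ → ℝ := fun x n => x ^ κ * Real.exp (κ * (n * h)) * T (x * Real.exp (n * h))
    with hS
  have hSR : ∀ x, 0 < x → ∀ n : ℕ,
      x ^ (-κ) * S x n = Real.exp (κ * (n * h)) * T (x * Real.exp (n * h)) := fun x hx n => by
    simp only [hS]
    rw [← mul_assoc, ← mul_assoc, ← Real.rpow_add hx, neg_add_cancel, Real.rpow_zero, one_mul]
  have hanti : ∀ x y, 0 < x → x ≤ y → ∀ n, y ^ (-κ) * S y n ≤ x ^ (-κ) * S x n := by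
    intro x y hx hxy n
    rw [hSR x hx, hSR y (hx.trans_le hxy)]
    gcongr
    exact hT (by gcongr)
  have hS0 : ∀ x, 0 < x → ∀ n, 0 ≤ S x n := fun x hx n => by
    have := hT0 (x * Real.exp (n * h))
    have := Real.rpow_pos_of_pos hx κ
    simp only [hS]
    positivity
  have hcancel : ∀ x, 0 < x → ∀ r : ℝ, x ^ κ * (x ^ (-κ) * r) = r := fun x hx r => by
    rw [← mul_assoc, ← Real.rpow_add hx, add_neg_cancel, Real.rpow_zero, one_mul]
  have hbelow : ∀ x, 0 < x → IsBoundedUnder (· ≥ ·) atTop (S x) := fun x hx =>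
    isBoundedUnder_of ⟨0, hS0 x hx⟩
  have habove : ∀ x, 0 < x → IsBoundedUnder (· ≤ ·) atTop (S x) := by
    intro x hx
    obtain ⟨y, hy, l, hl⟩ := hdense (x / 2) x (by positivity) (by linarith)
    have hy0 : 0 < y := lt_trans (by positivity) hy.1
    refine ((hl.const_mul (y ^ (-κ))).const_mul (x ^ κ)).isBoundedUnder_le.mono_le ?_
    refine Eventually.of_forall fun n => ?_
    calc S x n = x ^ κ * (x ^ (-κ) * S x n) := (hcancel x hx _).symm
      _ ≤ x ^ κ * (y ^ (-κ) * S y n) := by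
        have := hanti y x hy0 hy.2.le n
        gcongr
  have hlimsup : ∀ x, 0 < x → limsup (fun n => x ^ (-κ) * S x n) atTop =
      x ^ (-κ) * limsup (S x) atTop := fun x hx =>
    limsup_const_mul_of_pos (Real.rpow_pos_of_pos hx _) (habove x hx) (hbelow x hx)
  have hmul : ∀ x, 0 < x → IsBoundedUnder (· ≤ ·) atTop (fun n => x ^ (-κ) * S x n) := by
    intro x hx
    obtain ⟨C, hC⟩ := habove x hx
    refine ⟨x ^ (-κ) * C, ?_⟩
    rw [eventually_map] at hC ⊢
    filter_upwards [hC] with n hn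
    have := Real.rpow_pos_of_pos hx (-κ)
    gcongr
  refine ⟨fun x => limsup (S x) atTop, ⟨fun x hx => ?_, ?_, fun x hx => ?_⟩, fun x hx hcont => ?_⟩
  · exact le_limsup_of_frequently_le (Frequently.of_forall (hS0 x hx)) (habove x hx)
  · intro x hx y hy hxy
    simp only
    rw [← hlimsup x hx, ← hlimsup y hy]
    refine limsup_le_limsup (Eventually.of_forall (hanti x y hx hxy)) ?_ (hmul x hx)
    exact (isBoundedUnder_of ⟨0, fun n => mul_nonneg (Real.rpow_nonneg (le_of_lt hy) _)
      (hS0 y hy n)⟩ : IsBoundedUnder (· ≥ ·) atTop _).isCoboundedUnder_le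
  · have : S (x * Real.exp h) = fun n => S x (n + 1) := by
      funext n
      simp only [hS]
      rw [Real.mul_rpow hx.le (Real.exp_pos _).le, ← Real.exp_mul, mul_assoc x,
        ← Real.exp_add, mul_assoc (x ^ κ), ← Real.exp_add]
      push_cast
      congr 3 <;> ring_nf
    simp only [this]
    exact limsup_nat_add (S x) 1
  · have hr : ContinuousAt (fun y => y ^ (-κ) * limsup (S y) atTop) x :=
      (Real.continuousAt_rpow_const x _ (Or.inl hx.ne')).mul hcont
    have hgood : ∀ b c, 0 < b → b < c → ∃ y ∈ Set.Ioo b c,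
        Tendsto (fun n => y ^ (-κ) * S y n) atTop (𝓝 (y ^ (-κ) * limsup (S y) atTop)) := by
      intro b c hb hbc
      obtain ⟨y, hy, l, hl⟩ := hdense b c hb hbc
      refine ⟨y, hy, ?_⟩
      rw [hl.limsup_eq]
      exact hl.const_mul _
    have hlim : Tendsto (fun n => x ^ (-κ) * S x n) atTop
        (𝓝 (x ^ (-κ) * limsup (S x) atTop)) := by
      refine tendsto_order.2 ⟨fun a ha => ?_, fun a ha => ?_⟩
      · obtain ⟨c, hxc, hc⟩ := exists_Ico_subset_of_mem_nhds (hr.eventually (lt_mem_nhds ha))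
          ⟨x + 1, by linarith⟩
        obtain ⟨y, hy, hlim⟩ := hgood x c hx hxc
        filter_upwards [hlim.eventually (lt_mem_nhds (hc ⟨hy.1.le, hy.2⟩))] with n hn
        exact hn.trans_le (hanti x y hx hy.1.le n)
      · obtain ⟨b, hbx, hb⟩ := exists_Ioc_subset_of_mem_nhds (hr.eventually (gt_mem_nhds ha))
          ⟨x - 1, by linarith⟩
        obtain ⟨y, hy, hlim⟩ := hgood (max b (x / 2)) x (lt_max_of_lt_right (by positivity))
          (max_lt hbx (by linarith))
        have hy0 : 0 < y := lt_trans (lt_max_of_lt_right (by positivity)) hy.1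
        filter_upwards [hlim.eventually (gt_mem_nhds
          (hb ⟨(le_max_left _ _).trans_lt hy.1, hy.2.le⟩))] with n hn
        exact (hanti y x hy0 hy.2.le n).trans_lt hn
    refine ((hlim.const_mul (x ^ κ)).congr fun n => hcancel x hx _).trans ?_
    rw [hcancel x hx]

/-- Along almost every geometric progression an integrable function is summable. -/
theorem ae_summable_exp_mul {H : ℝ → ℝ} (hH : Measurable H) (hint : IntegrableOn H (Set.Ioi 0))
    {a h : ℝ} (ha : 0 < a) (hh : 0 < h) :
    ∀ᵐ x ∂volume.restrict (Set.Ico a (a * Real.exp h)),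
      Summable fun n : ℤ => Real.exp (n * h) * H (x * Real.exp (n * h)) := by
  set s := Set.Ico a (a * Real.exp h) with hs
  have himage : ∀ n : ℤ, (fun x => x * Real.exp (n * h)) '' s =
      Set.Ico (a * Real.exp (n * h)) (a * Real.exp ((n + 1 : ℤ) * h)) := fun n => by
    rw [hs, Set.image_mul_right_Ico _ _ (Real.exp_pos _), mul_assoc, ← Real.exp_add]
    push_cast
    ring_nf
  have hpiece : ∀ n : ℤ, ∫⁻ x in s, ‖Real.exp (n * h) * H (x * Real.exp (n * h))‖ₑ =
      ∫⁻ y in (fun x => x * Real.exp (n * h)) '' s, ‖H y‖ₑ := fun n => by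
    rw [lintegral_image_eq_lintegral_abs_deriv_mul (f := fun x => x * Real.exp (n * h))
      (f' := fun _ => Real.exp (n * h)) measurableSet_Ico
      (fun x _ => by simpa using ((hasDerivAt_id x).mul_const (Real.exp (n * h))).hasDerivWithinAt)
      (mul_left_injective₀ (Real.exp_pos _).ne').injOn]
    refine lintegral_congr fun x => ?_
    rw [enorm_mul, Real.enorm_eq_ofReal_abs]
  have hmono : StrictMono fun n : ℤ => a * Real.exp (n * h) := fun m n hmn => by
    have : (m : ℝ) < n := by exact_mod_cast hmn
    simp only
    gcongr
  have hdisj : Pairwise (Function.onFun Disjoint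
      fun n : ℤ => (fun x => x * Real.exp (n * h)) '' s) := by
    simp only [himage]
    exact hmono.monotone.pairwise_disjoint_on_Ico_succ
  have hfin : ∫⁻ x in s, ∑' n : ℤ, ‖Real.exp (n * h) * H (x * Real.exp (n * h))‖ₑ ≠ ⊤ := by
    rw [lintegral_tsum fun n => by fun_prop]
    simp only [hpiece]
    rw [← lintegral_iUnion (fun n => by rw [himage]; exact measurableSet_Ico) hdisj]
    refine ((lintegral_mono_set ?_).trans_lt hint.2).ne
    refine Set.iUnion_subset fun n => ?_
    rw [himage]
    exact fun y hy => lt_of_lt_of_le (by positivity) hy.1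
  filter_upwards [ae_lt_top' (by fun_prop) hfin] with x hx
  refine Summable.of_norm ?_
  have := ENNReal.summable_toReal hx.ne
  simpa using this

section Arithmetic

variable {Ω : Type*} [MeasurableSpace Ω] {P : Measure Ω} {A X : Ω → ℝ} {h : ℝ}

theorem lintegral_eq_tsum_of_arithmetic (hA : Measurable A) (hh : 0 < h)
    (hae : ∀ᵐ ω ∂P, A ω = 0 ∨ ∃ k : ℤ, A ω = Real.exp (k * h)) {F : Ω → ENNReal}
    (hF0 : ∀ ω, A ω = 0 → F ω = 0) :
    ∫⁻ ω, F ω ∂P = ∑' k : ℤ, ∫⁻ ω in {ω | A ω = Real.exp (k * h)}, F ω ∂P := by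
  have hmeas : ∀ k : ℤ, MeasurableSet {ω | A ω = Real.exp (k * h)} := fun k =>
    hA (measurableSet_singleton _)
  rw [← lintegral_iUnion hmeas, ← lintegral_indicator (MeasurableSet.iUnion hmeas)]
  · refine lintegral_congr_ae ?_
    filter_upwards [hae] with ω hω
    by_cases hmem : ω ∈ ⋃ k : ℤ, {ω | A ω = Real.exp (k * h)}
    · rw [Set.indicator_of_mem hmem]
    · rw [Set.indicator_of_notMem hmem]
      exact hF0 ω (hω.resolve_right fun ⟨k, hk⟩ => hmem (Set.mem_iUnion.2 ⟨k, hk⟩))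
  · intro i j hij
    refine Set.disjoint_left.2 fun ω hi hj => hij ?_
    have := Real.exp_injective ((show A ω = _ from hi).symm.trans hj)
    exact_mod_cast mul_right_cancel₀ hh.ne' this

theorem hasSum_toReal {f : ℤ → ENNReal} {c : ENNReal} (h : ∑' k, f k = c) (hc : c ≠ ⊤) :
    HasSum (fun k => (f k).toReal) c.toReal := by
  have hf : ∑' k, f k ≠ ⊤ := h ▸ hc
  rw [← h, ENNReal.tsum_toReal_eq fun k => ENNReal.ne_top_of_tsum_ne_top hf k]
  exact ENNReal.hasSum_toReal hf

theorem hasSum_of_arithmetic [IsProbabilityMeasure P] (hA : Measurable A) (hh : 0 < h)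
    (hae : ∀ᵐ ω ∂P, A ω = 0 ∨ ∃ k : ℤ, A ω = Real.exp (k * h)) {φ : ℝ → ℝ}
    (hφ0 : φ 0 = 0) (hφ : ∀ x, 0 < x → 0 ≤ φ x) {c : ENNReal}
    (hc : ∫⁻ ω, ENNReal.ofReal (φ (A ω)) ∂P = c) (hcT : c ≠ ⊤) :
    HasSum (fun k : ℤ => φ (Real.exp (k * h)) * (P {ω | A ω = Real.exp (k * h)}).toReal)
      c.toReal := by
  have hsum := lintegral_eq_tsum_of_arithmetic (F := fun ω => ENNReal.ofReal (φ (A ω))) hA hh hae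
    (fun ω hω => by simp [hω, hφ0])
  have hpiece : ∀ k : ℤ, ∫⁻ ω in {ω | A ω = Real.exp (k * h)}, ENNReal.ofReal (φ (A ω)) ∂P =
      ENNReal.ofReal (φ (Real.exp (k * h))) * P {ω | A ω = Real.exp (k * h)} := fun k => by
    have hm : MeasurableSet {ω | A ω = Real.exp (k * h)} := hA (measurableSet_singleton _)
    rw [← setLIntegral_const]
    exact setLIntegral_congr_fun hm fun ω hω => by rw [show A ω = _ from hω]
  simp only [hpiece, hc] at hsum
  refine (hasSum_toReal hsum.symm hcT).congr_fun fun k => ?_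
  rw [ENNReal.toReal_mul, ENNReal.toReal_ofReal (hφ _ (Real.exp_pos _))]

theorem hasSum_tail_mul [IsProbabilityMeasure P] (hA : Measurable A) (hX : Measurable X)
    (hindep : IndepFun A X P) (hh : 0 < h)
    (hae : ∀ᵐ ω ∂P, A ω = 0 ∨ ∃ k : ℤ, A ω = Real.exp (k * h)) {t : ℝ} (ht : 0 < t) :
    HasSum (fun k : ℤ => (P {ω | A ω = Real.exp (k * h)}).toReal *
      (P {ω | X ω > t * Real.exp (-(k * h))}).toReal) (P {ω | A ω * X ω > t}).toReal := by
  have hm : MeasurableSet {ω | A ω * X ω > t} := measurableSet_lt measurable_const (hA.mul hX)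
  have hsum := lintegral_eq_tsum_of_arithmetic (F := {ω | A ω * X ω > t}.indicator 1) hA hh hae
    fun ω hω => Set.indicator_of_notMem (by simp [hω, ht.le]) _
  have hpiece : ∀ k : ℤ,
      ∫⁻ ω in {ω | A ω = Real.exp (k * h)}, {ω | A ω * X ω > t}.indicator 1 ω ∂P =
      P {ω | A ω = Real.exp (k * h)} * P {ω | X ω > t * Real.exp (-(k * h))} := fun k => by
    rw [lintegral_indicator_one hm, Measure.restrict_apply hm,
      show P {ω | A ω = Real.exp (k * h)} * P {ω | X ω > t * Real.exp (-(k * h))} =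
        P (A ⁻¹' {Real.exp (k * h)}) * P (X ⁻¹' Set.Ioi (t * Real.exp (-(k * h)))) from rfl,
      ← hindep.measure_inter_preimage_eq_mul _ _ (measurableSet_singleton _) measurableSet_Ioi]
    congr 1
    ext ω
    simp only [Set.mem_inter_iff, Set.mem_ofPred_eq, Set.mem_preimage, Set.mem_singleton_iff,
      Set.mem_Ioi, gt_iff_lt]
    rw [and_comm]
    refine and_congr_right fun hω => ?_
    rw [hω, Real.exp_neg, ← div_eq_mul_inv, div_lt_iff₀ (Real.exp_pos _), mul_comm (X ω)]
  rw [lintegral_indicator_one hm] at hsum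
  simp only [hpiece] at hsum
  refine (hasSum_toReal hsum.symm (measure_ne_top _ _)).congr_fun fun k => ?_
  rw [ENNReal.toReal_mul]

end Arithmetic

theorem tendsto_tail_atTop {Ω : Type*} [MeasurableSpace Ω] {P : Measure Ω}
    [IsProbabilityMeasure P] {X : Ω → ℝ} (hX : Measurable X) :
    Tendsto (fun t => (P {ω | X ω > t}).toReal) atTop (𝓝 0) := by
  have := Measure.isProbabilityMeasure_map (μ := P) hX.aemeasurable
  have h : ∀ t, 1 - cdf (P.map X) t = (P {ω | X ω > t}).toReal := fun t => by
    rw [cdf_eq_real, ← probReal_compl_eq_one_sub measurableSet_Iic, Set.compl_Iic,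
      map_measureReal_apply hX measurableSet_Ioi]
    rfl
  simpa [h] using (tendsto_cdf_atTop (P.map X)).const_sub 1

theorem antitone_tail {Ω : Type*} [MeasurableSpace Ω] {P : Measure Ω}
    [IsProbabilityMeasure P] (X : Ω → ℝ) : Antitone fun t => (P {ω | X ω > t}).toReal :=
  fun _ _ hst => ENNReal.toReal_mono (measure_ne_top _ _)
    (measure_mono fun _ hω => lt_of_le_of_lt hst hω)

section StepLaw

variable {Ω : Type*} [MeasurableSpace Ω] (P : Measure Ω) (A : Ω → ℝ) (κ h : ℝ)

/-- The mass of `A` at `exp (k h)`. -/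
def stepMass (k : ℤ) : ℝ := (P {ω | A ω = Real.exp (k * h)}).toReal

/-- The law of `(log A) / h` on `ℤ`, exponentially tilted by `κ`. -/
def tiltedMass (k : ℤ) : ℝ := Real.exp (κ * (k * h)) * stepMass P A h k

variable {P A κ h}

theorem stepMass_nonneg (k : ℤ) : 0 ≤ stepMass P A h k := ENNReal.toReal_nonneg

theorem tiltedMass_nonneg (k : ℤ) : 0 ≤ tiltedMass P A κ h k :=
  mul_nonneg (Real.exp_pos _).le (stepMass_nonneg k)

theorem tiltedMass_mul_exp_neg (k : ℤ) :
    tiltedMass P A κ h k * Real.exp (-(κ * (k * h))) = stepMass P A h k := by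
  rw [tiltedMass, mul_right_comm, ← Real.exp_add, add_neg_cancel, Real.exp_zero, one_mul]

theorem ae_eq_zero_or_eq_exp (hA1 : AssumptionA1 P A κ h) :
    ∀ᵐ ω ∂P, A ω = 0 ∨ ∃ k : ℤ, A ω = Real.exp (k * h) := by
  obtain ⟨-, hA0, -, -, -, hspan, -⟩ := hA1
  filter_upwards [hA0, measure_eq_zero_iff_ae_notMem.1 hspan] with ω h0 h1
  by_cases hz : A ω = 0
  · exact Or.inl hz
  · simp only [not_and, not_forall, not_not] at h1
    obtain ⟨k, hk⟩ := h1 hz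
    exact Or.inr ⟨k, by rw [← hk, Real.exp_log (lt_of_le_of_ne h0 (Ne.symm hz))]⟩

theorem closure_tiltedMass_pos [IsProbabilityMeasure P] (hA1 : AssumptionA1 P A κ h) :
    AddSubgroup.closure {k | 0 < tiltedMass P A κ h k} = ⊤ := by
  have hae := ae_eq_zero_or_eq_exp hA1
  obtain ⟨-, -, -, -, hh, -, hmax⟩ := hA1
  by_contra hne
  set S := {k | 0 < tiltedMass P A κ h k} with hS
  obtain ⟨d, hd2, hd⟩ : ∃ d : ℤ, 2 ≤ d ∧ ∀ k ∈ S, d ∣ k := by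
    obtain ⟨d, hd⟩ := Int.subgroup_cyclic (AddSubgroup.closure S)
    rw [← AddSubgroup.zmultiples_eq_closure] at hd
    have hdvd : ∀ k ∈ S, d ∣ k := fun k hk => by
      rw [← Int.mem_zmultiples_iff, ← hd]
      exact AddSubgroup.subset_closure hk
    have hd1 : ¬ d ∣ 1 := fun h1 => hne <| by
      rw [hd, eq_top_iff, ← Int.zmultiples_one, AddSubgroup.zmultiples_le,
        Int.mem_zmultiples_iff]
      exact h1
    rcases eq_or_ne d 0 with rfl | hd0
    · exact ⟨2, le_rfl, fun k hk => by rw [zero_dvd_iff.1 (hdvd k hk)]; exact dvd_zero _⟩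
    · refine ⟨|d|, ?_, fun k hk => (abs_dvd d k).2 (hdvd k hk)⟩
      have h1 : |d| ≠ 1 := fun h1 => hd1 (by rw [← abs_dvd, h1])
      have := abs_pos.2 hd0
      omega
  have hsupp : ∀ᵐ ω ∂P, ∀ k : ℤ, A ω = Real.exp (k * h) → k ∈ S := by
    refine ae_all_iff.2 fun k => ?_
    by_cases hk : k ∈ S
    · exact Eventually.of_forall fun _ _ => hk
    · have h0 : stepMass P A h k = 0 := by
        by_contra hpos
        exact hk (mul_pos (Real.exp_pos _) (lt_of_le_of_ne (stepMass_nonneg k) (Ne.symm hpos)))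
      have h0' : P {ω | A ω = Real.exp (k * h)} = 0 :=
        (ENNReal.toReal_eq_zero_iff _).1 h0 |>.resolve_right (measure_ne_top _ _)
      filter_upwards [measure_eq_zero_iff_ae_notMem.1 h0'] with ω hω hω'
      exact absurd hω' hω
  have hd' : (2 : ℝ) ≤ d := by exact_mod_cast hd2
  have hle := hmax (d * h) (by positivity) <| measure_eq_zero_iff_ae_notMem.2 <| by
    filter_upwards [hae, hsupp] with ω h1 h2
    rintro ⟨hz, hk⟩
    obtain ⟨k, hAk⟩ := h1.resolve_left hz
    obtain ⟨j, rfl⟩ := hd k (h2 k hAk)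
    refine hk j ?_
    rw [hAk, Real.log_exp]
    push_cast
    ring
  nlinarith

theorem hasSum_tiltedMass [IsProbabilityMeasure P] (hA : Measurable A)
    (hA1 : AssumptionA1 P A κ h) : HasSum (tiltedMass P A κ h) 1 := by
  have hae := ae_eq_zero_or_eq_exp hA1
  obtain ⟨hκ, hA0, hint, -, hh, -⟩ := hA1
  have hi : Integrable (fun ω => A ω ^ κ) P := by
    by_contra hi
    rw [integral_undef hi] at hint
    exact zero_ne_one hint
  have h1 := ofReal_integral_eq_lintegral_ofReal hi
    (hA0.mono fun ω hω => Real.rpow_nonneg hω κ)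
  rw [hint] at h1
  have := hasSum_of_arithmetic (φ := fun a => a ^ κ) hA hh hae (Real.zero_rpow hκ.ne')
    (fun x hx => Real.rpow_nonneg hx.le _) h1.symm ENNReal.ofReal_ne_top
  rw [ENNReal.toReal_ofReal zero_le_one] at this
  refine this.congr_fun fun k => ?_
  rw [tiltedMass, stepMass, ← Real.exp_mul, mul_comm κ]

theorem exists_hasSum_stepMass [IsProbabilityMeasure P] (hA : Measurable A)
    (hA1 : AssumptionA1 P A κ h) : ∃ m ≤ 1, HasSum (stepMass P A h) m := by
  have hle : ∫⁻ ω, ENNReal.ofReal (if A ω = 0 then 0 else 1) ∂P ≤ 1 := by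
    calc _ ≤ ∫⁻ _, 1 ∂P := lintegral_mono fun ω => by split_ifs <;> simp
      _ = 1 := by simp
  have := hasSum_of_arithmetic (φ := fun a => if a = 0 then 0 else 1) hA hA1.2.2.2.2.1
    (ae_eq_zero_or_eq_exp hA1) (by simp) (fun x _ => by split_ifs <;> simp) rfl
    (hle.trans_lt ENNReal.one_lt_top).ne
  refine ⟨_, ENNReal.toReal_le_of_le_ofReal zero_le_one (by simpa using hle),
    this.congr_fun fun k => ?_⟩
  simp [stepMass, (Real.exp_pos _).ne']

theorem summable_tiltedMass_mul_abs [IsProbabilityMeasure P] (hA : Measurable A)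
    (hA1 : AssumptionA1 P A κ h) :
    Summable fun k : ℤ => tiltedMass P A κ h k * |(k : ℝ)| := by
  obtain ⟨m, -, hm⟩ := exists_hasSum_stepMass hA hA1
  have hae := ae_eq_zero_or_eq_exp hA1
  obtain ⟨hκ, -, -, hlog, hh, -⟩ := hA1
  have hpos := (hasSum_of_arithmetic (φ := fun a => a ^ κ * max (Real.log a) 0) hA hh hae
    (by simp) (fun x hx => mul_nonneg (Real.rpow_nonneg hx.le _) (le_max_right _ _)) rfl
    hlog.ne).summable
  refine Summable.of_nonneg_of_le (fun k => mul_nonneg (tiltedMass_nonneg k) (abs_nonneg _))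
    (fun k => ?_) ((hpos.mul_right h⁻¹).add (hm.summable.mul_right (κ * h)⁻¹))
  rw [← stepMass, Real.log_exp, ← Real.exp_mul, mul_comm _ κ]
  have hs := stepMass_nonneg (P := P) (A := A) (h := h) k
  rcases le_total 0 k with hk | hk
  · have hk' : (0 : ℝ) ≤ k := by exact_mod_cast hk
    rw [max_eq_left (by positivity), abs_of_nonneg hk', tiltedMass]
    have : Real.exp (κ * (k * h)) * (k * h) * stepMass P A h k * h⁻¹ =
        Real.exp (κ * (k * h)) * stepMass P A h k * k := by field_simp
    rw [this]
    have : 0 ≤ stepMass P A h k * (κ * h)⁻¹ := by positivity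
    linarith
  · have hk' : (k : ℝ) ≤ 0 := by exact_mod_cast hk
    rw [max_eq_right (mul_nonpos_of_nonpos_of_nonneg hk' hh.le), abs_of_nonpos hk', mul_zero,
      zero_mul, zero_mul, zero_add, tiltedMass, ← div_eq_mul_inv, le_div_iff₀ (by positivity)]
    have h1 : -(κ * (k * h)) ≤ Real.exp (-(κ * (k * h))) :=
      (by linarith [Real.add_one_le_exp (-(κ * (k * h)))])
    have h2 : Real.exp (κ * (k * h)) * Real.exp (-(κ * (k * h))) = 1 := by
      rw [← Real.exp_add, add_neg_cancel, Real.exp_zero]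
    calc _ = stepMass P A h k * (Real.exp (κ * (k * h)) * -(κ * (k * h))) := by ring
      _ ≤ stepMass P A h k * (Real.exp (κ * (k * h)) * Real.exp (-(κ * (k * h)))) := by gcongr
      _ = stepMass P A h k := by rw [h2, mul_one]

theorem exists_ne_zero_tiltedMass_pos [IsProbabilityMeasure P] (hA1 : AssumptionA1 P A κ h) :
    ∃ i ≠ 0, 0 < tiltedMass P A κ h i := by
  by_contra! hall
  have htop := closure_tiltedMass_pos hA1
  have hbot : AddSubgroup.closure {k | 0 < tiltedMass P A κ h k} = ⊥ :=
    (AddSubgroup.closure_eq_bot_iff).2 <| by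
      intro k hk
      by_contra h0
      exact absurd (hall k h0) (not_le.2 hk)
  exact bot_ne_top (hbot.symm.trans htop)

theorem exists_pos_tiltedMass_pos [IsProbabilityMeasure P] (hA : Measurable A)
    (hA1 : AssumptionA1 P A κ h) : ∃ b, 0 < b ∧ 0 < tiltedMass P A κ h b := by
  obtain ⟨i, hi0, hi⟩ := exists_ne_zero_tiltedMass_pos hA1
  obtain ⟨m, hm1, hm⟩ := exists_hasSum_stepMass hA hA1
  have hp := hasSum_tiltedMass hA hA1
  obtain ⟨hκ, -, -, -, hh, -⟩ := hA1
  by_contra! hneg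
  have hsupp : ∀ k, 0 < tiltedMass P A κ h k → k ≤ 0 := fun k hk =>
    not_lt.1 fun h0 => absurd (hneg k h0) (not_le.2 hk)
  have hle : ∀ k, tiltedMass P A κ h k ≤ stepMass P A h k := by
    intro k
    rcases (tiltedMass_nonneg (P := P) (A := A) (κ := κ) (h := h) k).eq_or_lt with h0 | h0
    · rw [← h0]
      exact stepMass_nonneg k
    · have hk : (k : ℝ) ≤ 0 := by exact_mod_cast hsupp k h0
      refine mul_le_of_le_one_left (stepMass_nonneg k) (Real.exp_le_one_iff.2 ?_)
      exact mul_nonpos_of_nonneg_of_nonpos hκ.le (mul_nonpos_of_nonpos_of_nonneg hk hh.le)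
  have hlt : tiltedMass P A κ h i < stepMass P A h i := by
    have hi' : (i : ℝ) < 0 := by exact_mod_cast lt_of_le_of_ne (hsupp i hi) hi0
    have hs : 0 < stepMass P A h i := hi.trans_le (hle i)
    refine mul_lt_of_lt_one_left hs (Real.exp_lt_one_iff.2 ?_)
    exact mul_neg_of_pos_of_neg hκ (mul_neg_of_neg_of_pos hi' hh)
  have := hasSum_lt hle hlt hp hm
  linarith

theorem exists_hasSum_tiltedMass_mul_exp [IsProbabilityMeasure P] (hA : Measurable A)
    (hA1 : AssumptionA1 P A κ h) : ∃ ρ < 1,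
      HasSum (fun k : ℤ => tiltedMass P A κ h k * Real.exp (-(κ * h / 2 * k))) ρ := by
  obtain ⟨i, hi0, hi⟩ := exists_ne_zero_tiltedMass_pos hA1
  obtain ⟨m, hm1, hm⟩ := exists_hasSum_stepMass hA hA1
  have hp := hasSum_tiltedMass hA hA1
  obtain ⟨hκ, -, -, -, hh, -⟩ := hA1
  have hsq : ∀ k : ℤ, Real.exp (-(κ * h / 2 * k)) ^ 2 = Real.exp (-(κ * (k * h))) := fun k => by
    rw [← Real.exp_nat_mul]
    congr 1
    push_cast
    ring
  have hdiff : ∀ k : ℤ, 2⁻¹ * (tiltedMass P A κ h k + stepMass P A h k) -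
      tiltedMass P A κ h k * Real.exp (-(κ * h / 2 * k)) =
      2⁻¹ * (tiltedMass P A κ h k * (1 - Real.exp (-(κ * h / 2 * k))) ^ 2) := fun k => by
    rw [← tiltedMass_mul_exp_neg (κ := κ) k, ← hsq]
    ring
  have hle : ∀ k : ℤ, tiltedMass P A κ h k * Real.exp (-(κ * h / 2 * k)) ≤
      2⁻¹ * (tiltedMass P A κ h k + stepMass P A h k) := fun k => by
    have := mul_nonneg (tiltedMass_nonneg (P := P) (A := A) (κ := κ) (h := h) k)
      (sq_nonneg (1 - Real.exp (-(κ * h / 2 * k))))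
    linarith [hdiff k]
  have hlt : tiltedMass P A κ h i * Real.exp (-(κ * h / 2 * i)) <
      2⁻¹ * (tiltedMass P A κ h i + stepMass P A h i) := by
    have hne : 1 - Real.exp (-(κ * h / 2 * i)) ≠ 0 := fun h0 => by
      have h1 : -(κ * h / 2 * i) = 0 := Real.exp_eq_one_iff _ |>.1 (by linarith)
      have : (i : ℝ) ≠ 0 := by exact_mod_cast hi0
      exact (mul_ne_zero (by positivity) this) (neg_eq_zero.1 h1)
    have := mul_pos hi (pow_pos (abs_pos.2 hne) 2)
    rw [sq_abs] at this
    linarith [hdiff i]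
  have hsum := (hp.add hm).mul_left 2⁻¹
  have hs : Summable fun k : ℤ => tiltedMass P A κ h k * Real.exp (-(κ * h / 2 * k)) :=
    Summable.of_nonneg_of_le (fun k => mul_nonneg (tiltedMass_nonneg k) (Real.exp_pos _).le)
      hle hsum.summable
  refine ⟨_, ?_, hs.hasSum⟩
  have := hasSum_lt hle hlt hs.hasSum hsum
  linarith

end StepLaw

/-- Convergence along a geometric progression on which the defect is summable. -/
theorem exists_tendsto_of_summable {Ω : Type*} [MeasurableSpace Ω] {P : Measure Ω}
    [IsProbabilityMeasure P] {A X : Ω → ℝ} (hA : Measurable A) (hX : Measurable X) {κ h : ℝ}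
    (hA1 : AssumptionA1 P A κ h) (hindep : IndepFun A X P) {x : ℝ} (hx : 0 < x)
    (hsum : Summable fun n : ℤ => Real.exp (n * h) * ((x * Real.exp (n * h)) ^ (κ - 1) *
      |(P {ω | X ω > x * Real.exp (n * h)}).toReal -
        (P {ω | A ω * X ω > x * Real.exp (n * h)}).toReal|)) :
    ∃ l, Tendsto (fun n : ℕ => x ^ κ * Real.exp (κ * (n * h)) *
      (P {ω | X ω > x * Real.exp (n * h)}).toReal) atTop (𝓝 l) := by
  have hae := ae_eq_zero_or_eq_exp hA1
  have hp := hasSum_tiltedMass hA hA1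
  obtain ⟨m, hm1, hm⟩ := exists_hasSum_stepMass hA hA1
  obtain ⟨b, hb, hpb⟩ := exists_pos_tiltedMass_pos hA hA1
  obtain ⟨ρ, hρ, hc⟩ := exists_hasSum_tiltedMass_mul_exp hA hA1
  have hκ : 0 < κ := hA1.1
  have hh : 0 < h := hA1.2.2.2.2.1
  obtain ⟨u, B, ℓ, huB, hu, hubot, hutop⟩ := exists_renewal_tendsto tiltedMass_nonneg hp.summable
    hp.tsum_eq (summable_tiltedMass_mul_abs hA hA1) (closure_tiltedMass_pos hA1) hb hpb
    (c := κ * h / 2) (by positivity) hc hρ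
  set T : ℝ → ℝ := fun t => (P {ω | X ω > t}).toReal with hT
  set T' : ℝ → ℝ := fun t => (P {ω | A ω * X ω > t}).toReal with hT'
  have hT0 : ∀ t, 0 ≤ T t := fun t => ENNReal.toReal_nonneg
  have hT1 : ∀ t, T t ≤ 1 := fun t => measureReal_le_one
  have hxκ : 0 < x ^ κ := Real.rpow_pos_of_pos hx κ
  set f : ℤ → ℝ := fun n => x ^ κ * Real.exp (κ * (n * h)) * T (x * Real.exp (n * h)) with hf
  have hexp : ∀ n k : ℤ, Real.exp (κ * ((n - k : ℤ) * h)) =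
      Real.exp (κ * (n * h)) * Real.exp (-(κ * (k * h))) := fun n k => by
    rw [← Real.exp_add]
    push_cast
    ring_nf
  have hfsum : ∀ n : ℤ, HasSum (fun k => tiltedMass P A κ h k * f (n - k))
      (x ^ κ * Real.exp (κ * (n * h)) * T' (x * Real.exp (n * h))) := fun n => by
    refine ((hasSum_tail_mul hA hX hindep hh hae
      (show 0 < x * Real.exp (n * h) by positivity)).mul_left
      (x ^ κ * Real.exp (κ * (n * h)))).congr_fun fun k => ?_
    have hy : x * Real.exp (n * h) * Real.exp (-(k * h)) = x * Real.exp ((n - k : ℤ) * h) := by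
      rw [mul_assoc, ← Real.exp_add]
      push_cast
      ring_nf
    rw [← stepMass, ← tiltedMass_mul_exp_neg (κ := κ) k, hy]
    simp only [hf, hT]
    rw [hexp]
    ring
  have hwsum : ∀ n : ℤ, HasSum (fun k => tiltedMass P A κ h k *
      (1 + Real.exp (κ * ((n - k : ℤ) * h)))) (1 + Real.exp (κ * (n * h)) * m) := fun n => by
    refine (hp.add (hm.mul_left (Real.exp (κ * (n * h))))).congr_fun fun k => ?_
    rw [hexp, ← tiltedMass_mul_exp_neg (κ := κ) k]
    ring
  have hlin_top : Tendsto (fun n : ℤ => (n : ℝ) * h) atTop atTop :=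
    (tendsto_intCast_atTop_iff.2 tendsto_id).atTop_mul_const hh
  have hlin_bot : Tendsto (fun n : ℤ => (n : ℝ) * h) atBot atBot :=
    (tendsto_intCast_atBot_iff.2 tendsto_id).atBot_mul_const hh
  have hfle : ∀ n, f n ≤ x ^ κ * Real.exp (κ * (n * h)) := fun n =>
    mul_le_of_le_one_right (by positivity) (hT1 _)
  have hf0 : ∀ n, 0 ≤ f n := fun n => by
    have := hT0 (x * Real.exp (n * h))
    simp only [hf]
    positivity
  have hψ : Summable fun n : ℤ =>
      x ^ κ * Real.exp (κ * (n * h)) * (T (x * Real.exp (n * h)) - T' (x * Real.exp (n * h))) := by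
    refine Summable.of_norm ((hsum.mul_left x).congr fun n => ?_)
    rw [norm_mul, Real.norm_of_nonneg (by positivity), Real.norm_eq_abs, ← mul_assoc, ← mul_assoc]
    congr 1
    have hy : 0 < x * Real.exp (n * h) := by positivity
    rw [Real.rpow_sub_one hy.ne', mul_div_cancel₀ _ hy.ne', Real.mul_rpow hx.le (Real.exp_pos _).le,
      ← Real.exp_mul, mul_comm _ κ]
  obtain ⟨l, hl⟩ := exists_tendsto_of_renewal_equation (f := f)
    (w := fun n => 1 + Real.exp (κ * (n * h))) tiltedMass_nonneg hp.summable hb.ne' hpb huB hu hubot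
    hutop (fun n => by linarith [Real.exp_pos (κ * (n * h))]) (fun n => (hwsum n).summable)
    (fun n => by
      rw [conv, (hwsum n).tsum_eq]
      have := mul_le_of_le_one_right (Real.exp_pos (κ * (n * h))).le hm1
      linarith)
    (tendsto_atTop_add_const_left _ _ (Real.tendsto_exp_atTop.comp (hlin_top.const_mul_atTop hκ)))
    (fun n => (hfsum n).summable)
    (squeeze_zero hf0 hfle <| by
      simpa using (Real.tendsto_exp_atBot.comp (hlin_bot.const_mul_atBot hκ)).const_mul (x ^ κ))
    (squeeze_zero (g := fun n : ℤ => x ^ κ * T (x * Real.exp (n * h)))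
      (fun n => div_nonneg (hf0 n) (by positivity))
      (fun n => by
        rw [div_le_iff₀ (by positivity)]
        have := mul_nonneg hxκ.le (hT0 (x * Real.exp (n * h)))
        simp only [hf]
        linarith)
      (by simpa using ((tendsto_tail_atTop (P := P) hX).comp
        ((Real.tendsto_exp_atTop.comp hlin_top).const_mul_atTop hx)).const_mul (x ^ κ)))
    hψ (fun n => by
      rw [conv, (hfsum n).tsum_eq]
      simp only [hf]
      ring)
  exact ⟨l, by simpa [Function.comp_def, hf] using hl.comp tendsto_natCast_atTop_atTop⟩

end ImplicitRenewal

/-- Theorem 1 (implicit renewal theorem, arithmetic case, finite mean):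
under (A1) and the integrability condition, there is `q ∈ 𝒬(κ,h)` such that
`x^κ e^{κnh} P(X > x e^{nh}) → q(x)` at every continuity point `x > 0` of `q`. -/
theorem stmt0 {Ω : Type*} [MeasurableSpace Ω] (P : Measure Ω) [IsProbabilityMeasure P]
    (A X : Ω → ℝ) (hAmeas : Measurable A) (hXmeas : Measurable X)
    (κ h : ℝ) (hA1 : AssumptionA1 P A κ h)
    (hindep : IndepFun A X P)
    (hint : IntegrableOn
      (fun y : ℝ => y ^ (κ - 1) *
        |(P {ω | X ω > y}).toReal - (P {ω | A ω * X ω > y}).toReal|)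
      (Set.Ioi (0 : ℝ))) :
    ∃ q : ℝ → ℝ, MemQ κ h q ∧
      ∀ x : ℝ, 0 < x → ContinuousAt q x →
        Tendsto (fun n : ℕ =>
            x ^ κ * Real.exp (κ * (n * h)) * (P {ω | X ω > x * Real.exp (n * h)}).toReal)
          atTop (𝓝 (q x)) := by
  have hh : 0 < h := hA1.2.2.2.2.1
  refine ImplicitRenewal.exists_memQ_of_dense_tendsto (ImplicitRenewal.antitone_tail X)
    (fun _ => ENNReal.toReal_nonneg) fun b c hb hbc => ?_
  have hmeas : Measurable fun y : ℝ => y ^ (κ - 1) *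
      |(P {ω | X ω > y}).toReal - (P {ω | A ω * X ω > y}).toReal| :=
    (measurable_id.pow_const _).mul
      ((ImplicitRenewal.antitone_tail X).measurable.sub
        (ImplicitRenewal.antitone_tail fun ω => A ω * X ω).measurable).abs
  have hae := ImplicitRenewal.ae_summable_exp_mul hmeas hint hb hh
  have hbe : b < b * Real.exp h := lt_mul_of_one_lt_right hb (Real.one_lt_exp_iff.2 hh)
  have hsub : Set.Ioo b (min c (b * Real.exp h)) ⊆ Set.Ico b (b * Real.exp h) := fun y hy =>
    ⟨hy.1.le, hy.2.trans_le (min_le_right _ _)⟩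
  have hne : volume (Set.Ioo b (min c (b * Real.exp h))) ≠ 0 := by
    rw [Real.volume_Ioo]
    simpa using ⟨hbc, hbe⟩
  have : NeBot (ae (volume.restrict (Set.Ioo b (min c (b * Real.exp h))))) :=
    ae_neBot.2 fun h0 => hne (Measure.restrict_eq_zero.1 h0)
  obtain ⟨y, hy, hys⟩ := ((ae_restrict_of_ae_restrict_of_subset hsub hae).and
    (ae_restrict_mem measurableSet_Ioo)).exists
  exact ⟨y, ⟨hys.1, hys.2.trans_le (min_le_left _ _)⟩,
    ImplicitRenewal.exists_tendsto_of_summable hAmeas hXmeas hA1 hindep (hb.trans hys.1) hy⟩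
end
end

section
/- Let A be a random variable satisfying Assumption (A1) with parameters κ > 0 and h > 0, and let X be a random variable independent of A such that ∫₀^∞ y^{κ−1} |P(X > y) − P(AX > y)| dy < ∞ and, in addition, Σ_{j∈ℤ} e^{κ(x+jh)} |P(X > e^{x+jh}) − P(AX > e^{x+jh})| < ∞ for every x ∈ ℝ. Then there exists a function q ∈ 𝒬(κ,h) such that for EVERY x > 0, lim_{n→∞} x^κ e^{κnh} P(X > x e^{nh}) = q(x). -/
open MeasureTheory ProbabilityTheory Filter Topology

noncomputable section

open scoped ENNReal

/-- One half of the Choquet–Deny theorem on `ℤ`. -/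
lemma le_sub_of_bounded_harmonic {a F : ℤ → ℝ} {B : ℝ} (ha0 : ∀ i, 0 ≤ a i) (ha : HasSum a 1)
    (hB : ∀ j, |F j| ≤ B) (hF : ∀ j, HasSum (fun i => a i * F (j - i)) (F j))
    {k : ℤ} (hk : 0 < a k) (j : ℤ) : F j ≤ F (j - k) := by
  by_contra! hj
  set D : ℤ → ℝ := fun n => F n - F (n - k) with hD
  have hbdd : BddAbove (Set.range D) := by
    refine ⟨B + B, ?_⟩
    rintro _ ⟨n, rfl⟩
    have h1 := abs_le.1 (hB n)
    have h2 := abs_le.1 (hB (n - k))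
    simp only [hD]
    linarith
  set S := ⨆ n, D n with hS
  have hDS : ∀ n, D n ≤ S := fun n => le_ciSup hbdd n
  have hSpos : 0 < S := lt_of_lt_of_le (by simp only [hD]; linarith) (hDS j)
  have hDharm : ∀ n, HasSum (fun i => a i * D (n - i)) (D n) := by
    intro n
    refine ((hF n).sub (hF (n - k))).congr_fun fun i => ?_
    simp only [hD]
    rw [show n - k - i = n - i - k by ring]
    ring
  have hstep : ∀ n, a k * (S - D (n - k)) ≤ S - D n := by
    intro n
    have h : HasSum (fun i => a i * (S - D (n - i))) (S - D n) := by
      have := (ha.mul_right S).sub (hDharm n)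
      simp only [one_mul] at this
      refine this.congr_fun ?_
      intro i
      ring
    exact le_hasSum h k fun i _ => mul_nonneg (ha0 i) (sub_nonneg.2 (hDS _))
  have hiter : ∀ (m : ℕ) (n : ℤ), a k ^ m * (S - D (n - m * k)) ≤ S - D n := by
    intro m
    induction m with
    | zero => intro n; simp
    | succ m ih =>
      intro n
      have h1 := mul_le_mul_of_nonneg_left (hstep (n - m * k)) (pow_nonneg hk.le m)
      have h2 := ih n
      push_cast
      rw [show n - ((m : ℤ) + 1) * k = n - m * k - k by ring, pow_succ, mul_assoc]
      linarith
  have hak1 : a k ≤ 1 := le_hasSum ha k fun i _ => ha0 i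
  obtain ⟨m, hm⟩ := exists_nat_gt (4 * B / S)
  obtain ⟨n, hn⟩ := exists_lt_of_lt_ciSup
    (show S - a k ^ m * (S / 2) < ⨆ n, D n from sub_lt_self _ (by positivity))
  have hlow : ∀ i ∈ Finset.range m, S / 2 ≤ D (n - i * k) := by
    intro i hi
    have hp : a k ^ m ≤ a k ^ i := pow_le_pow_of_le_one hk.le hak1 (Finset.mem_range.1 hi).le
    have hpi : 0 < a k ^ i := pow_pos hk i
    have h1 : a k ^ i * (S - D (n - i * k)) ≤ a k ^ i * (S / 2) := by
      have := hiter i n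
      have := mul_le_mul_of_nonneg_right hp (half_pos hSpos).le
      linarith
    have := le_of_mul_le_mul_left h1 hpi
    linarith
  have htel : ∑ i ∈ Finset.range m, D (n - i * k) = F n - F (n - m * k) := by
    have := Finset.sum_range_sub' (fun i : ℕ => F (n - i * k)) m
    simp only [Nat.cast_zero, zero_mul, sub_zero] at this
    rw [← this]
    refine Finset.sum_congr rfl fun i _ => ?_
    simp only [hD]
    push_cast
    rw [show n - ((i : ℤ) + 1) * k = n - i * k - k by ring]
  have hsum := Finset.card_nsmul_le_sum _ _ _ hlow
  rw [htel, Finset.card_range, nsmul_eq_mul] at hsum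
  rw [div_lt_iff₀ hSpos] at hm
  have h1 := abs_le.1 (hB n)
  have h2 := abs_le.1 (hB (n - m * k))
  linarith

/-- Bounded harmonic functions of a random walk on `ℤ` are invariant under its steps. -/
lemma eq_sub_of_bounded_harmonic {a F : ℤ → ℝ} {B : ℝ} (ha0 : ∀ i, 0 ≤ a i) (ha : HasSum a 1)
    (hB : ∀ j, |F j| ≤ B) (hF : ∀ j, HasSum (fun i => a i * F (j - i)) (F j))
    {k : ℤ} (hk : 0 < a k) (j : ℤ) : F j = F (j - k) := by
  refine le_antisymm (le_sub_of_bounded_harmonic ha0 ha hB hF hk j) ?_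
  have := le_sub_of_bounded_harmonic (F := fun j => -F j) ha0 ha (by simpa using hB)
    (fun j => by simpa using (hF j).neg) hk j
  simpa using this

/-- Bounded harmonic functions of an aperiodic random walk on `ℤ` are constant. -/
lemma const_of_bounded_harmonic {a F : ℤ → ℝ} {B : ℝ} (ha0 : ∀ i, 0 ≤ a i) (ha : HasSum a 1)
    (hap : ∀ d : ℕ, (∀ k, a k ≠ 0 → (d : ℤ) ∣ k) → d = 1)
    (hB : ∀ j, |F j| ≤ B) (hF : ∀ j, HasSum (fun i => a i * F (j - i)) (F j)) (j : ℤ) :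
    F j = F 0 := by
  let H : AddSubgroup ℤ :=
    { carrier := {k | ∀ j, F j = F (j - k)}
      zero_mem' := by simp
      add_mem' := by
        intro x y hx hy j
        rw [hx j, hy (j - x), sub_sub]
      neg_mem' := by
        intro x hx j
        rw [hx (j - -x)]
        congr 1
        ring }
  obtain ⟨d, hd⟩ := Int.subgroup_cyclic H
  have hd1 : d.natAbs = 1 := by
    refine hap _ fun k hk => ?_
    have hkH : k ∈ H := fun j =>
      eq_sub_of_bounded_harmonic ha0 ha hB hF ((ha0 k).lt_of_ne' hk) j
    rw [hd, AddSubgroup.mem_closure_singleton] at hkH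
    obtain ⟨n, rfl⟩ := hkH
    simp
  have hj : j ∈ H := by
    rw [hd, AddSubgroup.mem_closure_singleton]
    rcases Int.natAbs_eq_iff.1 hd1 with h | h
    · exact ⟨j, by simp [h]⟩
    · exact ⟨-j, by simp [h]⟩
  simpa using hj j

/-- Every function on `ℤ` has an antidifference. -/
lemma exists_antidifference (f : ℤ → ℝ) : ∃ Φ : ℤ → ℝ, ∀ n, Φ n - Φ (n - 1) = f n := by
  refine ⟨fun n => ∑ l ∈ Finset.Ioc 0 n, f l - ∑ l ∈ Finset.Ioc n 0, f l, fun n => ?_⟩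
  rcases le_or_gt n 0 with hn | hn
  · have h1 : Finset.Ioc 0 n = ∅ := Finset.Ioc_eq_empty (by omega)
    have h2 : Finset.Ioc 0 (n - 1) = ∅ := Finset.Ioc_eq_empty (by omega)
    have h3 : Finset.Ioc (n - 1) 0 = insert n (Finset.Ioc n 0) := by
      ext x; simp only [Finset.mem_Ioc, Finset.mem_insert]; omega
    simp only [h1, h2, h3]
    rw [Finset.sum_insert (by simp)]
    simp
  · have h1 : Finset.Ioc n 0 = ∅ := Finset.Ioc_eq_empty (by omega)
    have h2 : Finset.Ioc (n - 1) 0 = ∅ := Finset.Ioc_eq_empty (by omega)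
    have h3 : Finset.Ioc 0 n = insert n (Finset.Ioc 0 (n - 1)) := by
      ext x; simp only [Finset.mem_Ioc, Finset.mem_insert]; omega
    simp only [h1, h2, h3]
    rw [Finset.sum_insert (by simp)]
    simp

lemma abs_sub_le_of_step_le {Φ : ℤ → ℝ} {B : ℝ} (hΦ : ∀ n, |Φ n - Φ (n - 1)| ≤ B) (i : ℤ) :
    ∀ n, |Φ n - Φ (n - i)| ≤ B * |(i : ℝ)| := by
  have key : ∀ (m : ℕ) (n : ℤ), |Φ n - Φ (n - m)| ≤ B * m := by
    intro m
    induction m with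
    | zero => simp
    | succ m ih =>
      intro n
      have h1 := ih n
      have h2 := hΦ (n - m)
      have h3 := abs_sub_le (Φ n) (Φ (n - m)) (Φ (n - (m + 1 : ℕ)))
      rw [show n - ((m + 1 : ℕ) : ℤ) = n - m - 1 by push_cast; ring] at *
      push_cast
      linarith
  intro n
  obtain ⟨m, rfl | rfl⟩ := Int.eq_nat_or_neg i
  · simpa using key m n
  · have := key m (n + m)
    rw [abs_sub_comm]
    simpa using this

lemma tendsto_sub_of_step {Φ : ℤ → ℝ} {l : Filter ℤ} {c : ℝ}
    (hΦ : ∀ i : ℤ, Tendsto (fun n => Φ (n + i) - Φ (n + i - 1)) l (𝓝 c)) (i : ℤ) :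
    Tendsto (fun n => Φ n - Φ (n - i)) l (𝓝 (i * c)) := by
  have key : ∀ (m : ℕ) (j : ℤ),
      Tendsto (fun n => Φ (n + j) - Φ (n + j - m)) l (𝓝 (m * c)) := by
    intro m
    induction m with
    | zero => simp [tendsto_const_nhds]
    | succ m ih =>
      intro j
      convert (ih j).add (hΦ (j - m)) using 2 with n
      · rw [show n + j - ((m + 1 : ℕ) : ℤ) = n + (j - m) - 1 by push_cast; ring,
          show n + j - (m : ℤ) = n + (j - m) by ring]
        ring
      · push_cast; ring
  obtain ⟨m, rfl | rfl⟩ := Int.eq_nat_or_neg i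
  · simpa using key m 0
  · convert (key m m).neg using 2 with n
    · simp
    · simp

/-- The renewal theorem on `ℤ` for bounded solutions of the renewal equation. -/
theorem exists_tendsto_of_renewal_equation {a f g : ℤ → ℝ} {B : ℝ} (ha0 : ∀ i, 0 ≤ a i)
    (ha : HasSum a 1) (ha_abs : Summable fun i : ℤ => a i * |(i : ℝ)|)
    (hmean : ∑' i : ℤ, a i * (i : ℝ) ≠ 0)
    (hap : ∀ d : ℕ, (∀ k, a k ≠ 0 → (d : ℤ) ∣ k) → d = 1)
    (hB : ∀ j, |f j| ≤ B) (hg : Summable g)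
    (hfg : ∀ j, f j = g j + ∑' i, a i * f (j - i)) :
    ∃ c, Tendsto f atTop (𝓝 c) := by
  obtain ⟨Φ, hΦ⟩ := exists_antidifference f
  have hB0 : 0 ≤ B := (abs_nonneg _).trans (hB 0)
  have hΦB := abs_sub_le_of_step_le (Φ := Φ) (B := B) (fun n => by rw [hΦ]; exact hB n)
  set R : ℤ → ℝ := fun n => ∑' i, a i * (Φ n - Φ (n - i)) with hR
  have hbound : ∀ n i : ℤ, ‖a i * (Φ n - Φ (n - i))‖ ≤ B * (a i * |(i : ℝ)|) := by
    intro n i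
    rw [norm_mul, Real.norm_eq_abs, Real.norm_eq_abs, abs_of_nonneg (ha0 i)]
    calc _ ≤ a i * (B * |(i : ℝ)|) := mul_le_mul_of_nonneg_left (hΦB i n) (ha0 i)
      _ = _ := by ring
  have hRs : ∀ n, Summable fun i => a i * (Φ n - Φ (n - i)) := fun n =>
    Summable.of_norm_bounded (ha_abs.mul_left B) (hbound n)
  have hfb : ∀ j i : ℤ, ‖a i * f (j - i)‖ ≤ B * a i := by
    intro j i
    rw [norm_mul, Real.norm_eq_abs, Real.norm_eq_abs, abs_of_nonneg (ha0 i), mul_comm B]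
    exact mul_le_mul_of_nonneg_left (hB _) (ha0 i)
  have hfs : ∀ j, Summable fun i => a i * f (j - i) := fun j =>
    Summable.of_norm_bounded (ha.summable.mul_left B) (hfb j)
  have hRg : ∀ n, R n - R (n - 1) = g n := by
    intro n
    have h1 : R n - R (n - 1) = ∑' i, (a i * f n - a i * f (n - i)) := by
      rw [hR]
      simp only
      rw [← (hRs n).tsum_sub (hRs (n - 1))]
      refine tsum_congr fun i => ?_
      rw [← hΦ n, ← hΦ (n - i), show n - 1 - i = n - i - 1 by ring]
      ring
    rw [h1, (ha.summable.mul_right _).tsum_sub (hfs n), tsum_mul_right, ha.tsum_eq, one_mul]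
    linarith [hfg n]
  obtain ⟨ℓ, hℓ⟩ : ∃ ℓ, Tendsto R atTop (𝓝 ℓ) := by
    have hs : Summable fun n : ℕ => g (n + 1) :=
      hg.comp_injective (i := fun n : ℕ => (n : ℤ) + 1) fun x y hxy => by simpa using hxy
    refine ⟨(∑' n : ℕ, g (n + 1)) + R 0, ?_⟩
    rw [← Nat.map_cast_int_atTop, tendsto_map'_iff]
    refine (hs.hasSum.tendsto_sum_nat.add_const (R 0)).congr fun n => ?_
    have := Finset.sum_range_sub (fun n : ℕ => R n) n
    simp only [Nat.cast_zero] at this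
    have h2 : ∑ i ∈ Finset.range n, g (i + 1) = R n - R 0 := by
      rw [← this]
      refine Finset.sum_congr rfl fun i _ => ?_
      rw [← hRg]
      simp
    simp [h2]
  set m := ∑' i : ℤ, a i * (i : ℝ) with hm
  refine ⟨ℓ / m, tendsto_iff_ultrafilter _ _ _ |>.2 fun 𝒰 h𝒰 => ?_⟩
  have hlim : ∀ i : ℤ, ∃ y ∈ Set.Icc (-B) B, Tendsto (fun n => f (n + i)) 𝒰 (𝓝 y) := by
    intro i
    exact isCompact_Icc.ultrafilter_le_nhds' (𝒰.map fun n : ℤ => f (n + i))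
      (Ultrafilter.mem_map.2 (Filter.univ_mem' fun n => abs_le.1 (hB (n + i))))
  choose F hFB hF using hlim
  have hshift : ∀ i : ℤ, Tendsto (fun n : ℤ => n + i) 𝒰 atTop := fun i =>
    (tendsto_atTop_add_const_right _ i tendsto_id).mono_left h𝒰
  have hg0 : Tendsto g atTop (𝓝 0) :=
    hg.tendsto_cofinite_zero.mono_left atTop_le_cofinite
  have hharm : ∀ j, HasSum (fun i => a i * F (j - i)) (F j) := by
    intro j
    have hb : ∀ i, ‖a i * F (j - i)‖ ≤ B * a i := by
      intro i
      rw [norm_mul, Real.norm_eq_abs, Real.norm_eq_abs, abs_of_nonneg (ha0 i), mul_comm B]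
      exact mul_le_mul_of_nonneg_left (abs_le.2 (hFB _)) (ha0 i)
    have hs : Summable fun i => a i * F (j - i) :=
      Summable.of_norm_bounded (ha.summable.mul_left B) hb
    have h1 : Tendsto (fun n : ℤ => ∑' i, a i * f (n + j - i)) 𝒰 (𝓝 (∑' i, a i * F (j - i))) := by
      refine tendsto_tsum_of_dominated_convergence (ha.summable.mul_left B) (fun i => ?_)
        (Filter.Eventually.of_forall fun n i => hfb (n + j) i)
      simpa only [add_sub_assoc] using (hF (j - i)).const_mul (a i)
    have h2 := (hg0.comp (hshift j)).add h1
    rw [zero_add] at h2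
    have h3 : F j = ∑' i, a i * F (j - i) :=
      tendsto_nhds_unique (hF j) (h2.congr fun n => (hfg (n + j)).symm)
    rw [h3]
    exact hs.hasSum
  have hconst := const_of_bounded_harmonic ha0 ha hap (fun j => abs_le.2 (hFB j)) hharm
  have hRlim : Tendsto R 𝒰 (𝓝 (∑' i : ℤ, a i * (i * F 0))) := by
    refine tendsto_tsum_of_dominated_convergence (ha_abs.mul_left B) (fun i => ?_)
      (Filter.Eventually.of_forall hbound)
    refine (tendsto_sub_of_step (fun i => ?_) i).const_mul (a i)
    simp only [hΦ]
    rw [← hconst i]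
    exact hF i
  have heq : m * F 0 = ℓ := by
    rw [hm, ← tsum_mul_right]
    simp only [mul_assoc]
    exact tendsto_nhds_unique hRlim (hℓ.mono_left h𝒰)
  rw [← heq, mul_div_cancel_left₀ _ hmean]
  simpa using hF 0

/-- A nonnegative subsolution of a renewal equation is bounded as soon as it is negligible with
respect to an excessive function `u`, up to a multiple of a strictly contracted function `v`. -/
theorem le_of_renewal_subsolution {a f g u v : ℤ → ℝ≥0∞} {φ : ℝ≥0∞} (ha : ∑' i, a i ≤ 1)
    (hφ : φ < 1) (hu : ∀ j, ∑' i, a i * u (j - i) ≤ u j)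
    (hv : ∀ j, ∑' i, a i * v (j - i) ≤ φ * v j) (hv0 : v 0 = 1)
    (hu_top : ∀ j, u j ≠ ∞) (hv_top : ∀ j, v j ≠ ∞)
    (hfg : ∀ j, f j ≤ g j + ∑' i, a i * f (j - i))
    (hf : ∀ ε : ℝ≥0∞, 0 < ε → ∃ C : ℝ≥0∞, C ≠ ∞ ∧ ∀ j, f j ≤ ε * u j + C * v j) (j : ℤ) :
    f j ≤ (1 - φ)⁻¹ * ∑' i, g i := by
  set K := (1 - φ)⁻¹ with hK
  have hK1 : 1 + φ * K = K := by
    have h1 : (1 - φ) * K = 1 :=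
      ENNReal.mul_inv_cancel (tsub_pos_of_lt hφ).ne' (by simp)
    calc 1 + φ * K = (1 - φ) * K + φ * K := by rw [h1]
      _ = K := by rw [← add_mul, tsub_add_cancel_of_le hφ.le, one_mul]
  set V : ℤ → ℝ≥0∞ := fun j => K * min 1 (v j) with hV
  have hTV1 : ∀ j, ∑' i, a i * V (j - i) ≤ K := by
    intro j
    calc _ ≤ ∑' i, a i * K := by
            refine ENNReal.tsum_le_tsum fun i => ?_
            gcongr
            exact mul_le_of_le_one_right' (min_le_left _ _)
      _ ≤ K := by
            rw [ENNReal.tsum_mul_right]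
            exact mul_le_of_le_one_left' ha
  have hTV2 : ∀ j, ∑' i, a i * V (j - i) ≤ K * (φ * v j) := by
    intro j
    calc _ ≤ ∑' i, K * (a i * v (j - i)) := by
            refine ENNReal.tsum_le_tsum fun i => ?_
            rw [mul_left_comm]
            gcongr
            exact min_le_right _ _
      _ ≤ _ := by
            rw [ENNReal.tsum_mul_left]
            gcongr
            exact hv j
  have hVsuper : ∀ j, (if j = 0 then 1 else 0) + ∑' i, a i * V (j - i) ≤ V j := by
    intro j
    split_ifs with hj
    · subst hj
      calc _ ≤ 1 + K * (φ * v 0) := by gcongr; exact hTV2 0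
        _ = V 0 := by simp [hV, hv0, mul_comm K, hK1]
    · rw [zero_add]
      rcases le_total 1 (v j) with h | h
      · simpa [hV, h] using hTV1 j
      · refine (hTV2 j).trans ?_
        simp only [hV, h, inf_of_le_right]
        gcongr
        exact mul_le_of_le_one_left' hφ.le
  set W : ℤ → ℝ≥0∞ := fun j => ∑' l, g l * V (j - l) with hW
  have hWsuper : ∀ j, g j + ∑' i, a i * W (j - i) ≤ W j := by
    intro j
    calc _ = ∑' l, g l * ((if j - l = 0 then 1 else 0) + ∑' i, a i * V (j - l - i)) := by
            simp only [mul_add, ENNReal.tsum_add, hW, ← ENNReal.tsum_mul_left]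
            congr 1
            · rw [tsum_eq_single j]
              · simp
              · intro l hl
                simp [sub_eq_zero, hl.symm]
            · rw [ENNReal.tsum_comm]
              refine tsum_congr fun l => tsum_congr fun i => ?_
              rw [mul_left_comm, show j - i - l = j - l - i by ring]
      _ ≤ W j := ENNReal.tsum_le_tsum fun l => by gcongr; exact hVsuper (j - l)
  have hfW : ∀ ε : ℝ≥0∞, 0 < ε → ∀ j, f j ≤ W j + ε * u j := by
    intro ε hε
    obtain ⟨C, hC, hfC⟩ := hf ε hε
    have hiter : ∀ n : ℕ, ∀ j, f j ≤ W j + (ε * u j + C * φ ^ n * v j) := by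
      intro n
      induction n with
      | zero => intro j; exact (hfC j).trans (by simp)
      | succ n ih =>
        intro j
        calc f j ≤ g j + ∑' i, a i * f (j - i) := hfg j
          _ ≤ g j + ∑' i, a i *
                (W (j - i) + (ε * u (j - i) + C * φ ^ n * v (j - i))) := by
              gcongr with i
              exact ih _
          _ = (g j + ∑' i, a i * W (j - i)) + (ε * ∑' i, a i * u (j - i) +
                C * φ ^ n * ∑' i, a i * v (j - i)) := by
              simp only [mul_add, ENNReal.tsum_add, ← ENNReal.tsum_mul_left, mul_left_comm (a _)]
              ring
          _ ≤ W j + (ε * u j + C * φ ^ n * (φ * v j)) := by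
              gcongr
              · exact hWsuper j
              · exact hu j
              · exact hv j
          _ = _ := by ring
    intro j
    have hlim : Tendsto (fun n : ℕ => W j + (ε * u j + C * φ ^ n * v j)) atTop
        (𝓝 (W j + (ε * u j + C * 0 * v j))) := by
      refine tendsto_const_nhds.add (tendsto_const_nhds.add ?_)
      refine ENNReal.Tendsto.mul_const ?_ (Or.inr (hv_top j))
      exact ENNReal.Tendsto.const_mul (ENNReal.tendsto_pow_atTop_nhds_zero_of_lt_one hφ)
        (Or.inr hC)
    simpa using ge_of_tendsto' hlim fun n => hiter n j
  have hfW' : f j ≤ W j := by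
    have hlim : Tendsto (fun ε : ℝ≥0∞ => W j + ε * u j) (𝓝[>] 0) (𝓝 (W j + 0 * u j)) := by
      refine tendsto_const_nhds.add ?_
      exact (ENNReal.Tendsto.mul_const tendsto_id (Or.inr (hu_top j))).mono_left
        nhdsWithin_le_nhds
    simpa using ge_of_tendsto hlim (eventually_nhdsWithin_of_forall fun ε hε => hfW ε hε j)
  refine hfW'.trans ?_
  rw [← ENNReal.tsum_mul_left]
  refine ENNReal.tsum_le_tsum fun l => ?_
  rw [mul_comm]
  gcongr
  exact mul_le_of_le_one_right' (min_le_left _ _)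

lemma tsum_ofReal_mul_of_hasSum {x y : ℤ → ℝ} {z : ℝ} (hx : ∀ i, 0 ≤ x i) (hy : ∀ i, 0 ≤ y i)
    (h : HasSum (fun i => x i * y i) z) :
    ∑' i, ENNReal.ofReal (x i) * ENNReal.ofReal (y i) = ENNReal.ofReal z := by
  simp_rw [← ENNReal.ofReal_mul (hx _)]
  rw [← ENNReal.ofReal_tsum_of_nonneg (fun i => mul_nonneg (hx i) (hy i)) h.summable, h.tsum_eq]

section ExponentialTilting

variable {p : ℤ → ℝ} {θ : ℝ}

lemma summable_tilted_abs (hp0 : ∀ k, 0 ≤ p k) (hθ : 0 < θ) (hps : Summable p)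
    (hlog : Summable fun k : ℤ => p k * Real.exp (θ * k) * max (k : ℝ) 0) :
    Summable fun k : ℤ => p k * Real.exp (θ * k) * |(k : ℝ)| := by
  refine Summable.of_nonneg_of_le (fun k => ?_) (fun k => ?_) (hlog.add (hps.mul_right θ⁻¹))
  · have := hp0 k
    positivity
  · rw [mul_assoc, mul_assoc, ← mul_add]
    refine mul_le_mul_of_nonneg_left ?_ (hp0 k)
    rcases le_total 0 (k : ℝ) with hk | hk
    · rw [abs_of_nonneg hk, max_eq_left hk]
      have : 0 < θ⁻¹ := inv_pos.2 hθ
      linarith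
    · rw [abs_of_nonpos hk, max_eq_right hk, mul_zero, zero_add, ← one_div, le_div_iff₀ hθ]
      have h1 := Real.add_one_le_exp (-(θ * k))
      have h2 : Real.exp (θ * k) * Real.exp (-(θ * k)) = 1 := by
        rw [← Real.exp_add]; simp
      have h3 := Real.exp_pos (θ * k)
      nlinarith

lemma tilted_mean_ne_zero (hp0 : ∀ k, 0 ≤ p k) (hθ : 0 < θ) (hps : Summable p)
    (hp1 : ∑' k, p k ≤ 1) (ha : HasSum (fun k : ℤ => p k * Real.exp (θ * k)) 1)
    (habs : Summable fun k : ℤ => p k * Real.exp (θ * k) * |(k : ℝ)|)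
    {k₀ : ℤ} (hk₀ : k₀ ≠ 0) (hpk₀ : p k₀ ≠ 0) :
    ∑' k : ℤ, p k * Real.exp (θ * k) * (k : ℝ) ≠ 0 := by
  have hs : Summable fun k : ℤ => p k * Real.exp (θ * k) * (k : ℝ) := by
    refine Summable.of_norm_bounded habs fun k => ?_
    have := hp0 k
    rw [norm_mul, Real.norm_eq_abs, Real.norm_eq_abs, abs_of_nonneg (by positivity)]
  have hlt : ∑' k : ℤ, (p k * Real.exp (θ * k) - p k) <
      ∑' k : ℤ, θ * (p k * Real.exp (θ * k) * (k : ℝ)) := by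
    have hkey : ∀ x : ℝ, Real.exp x * Real.exp (-x) = 1 := fun x => by
      rw [← Real.exp_add]; simp
    refine Summable.tsum_lt_tsum (i := k₀) (fun k => ?_) ?_ (ha.summable.sub hps) (hs.mul_left θ)
    · have h1 := Real.add_one_le_exp (-(θ * k))
      have h2 := hkey (θ * k)
      have h3 := Real.exp_pos (θ * k)
      have h4 : Real.exp (θ * k) - 1 ≤ θ * (Real.exp (θ * k) * k) := by nlinarith
      have := mul_le_mul_of_nonneg_left h4 (hp0 k)
      linarith
    · have hne : -(θ * (k₀ : ℝ)) ≠ 0 := by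
        have : (k₀ : ℝ) ≠ 0 := by exact_mod_cast hk₀
        simp [hθ.ne', this]
      have h1 := Real.add_one_lt_exp hne
      have h2 := hkey (θ * k₀)
      have h3 := Real.exp_pos (θ * k₀)
      have h4 : Real.exp (θ * k₀) - 1 < θ * (Real.exp (θ * k₀) * k₀) := by nlinarith
      have := mul_lt_mul_of_pos_left h4 ((hp0 k₀).lt_of_ne' hpk₀)
      linarith
  rw [ha.summable.tsum_sub hps, ha.tsum_eq, tsum_mul_left] at hlt
  intro h0
  rw [h0] at hlt
  linarith

lemma exists_hasSum_half_tilt_lt_one (hp0 : ∀ k, 0 ≤ p k) (hθ : 0 < θ) (hps : Summable p)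
    (hp1 : ∑' k, p k ≤ 1) (ha : HasSum (fun k : ℤ => p k * Real.exp (θ * k)) 1)
    {k₀ : ℤ} (hk₀ : k₀ ≠ 0) (hpk₀ : p k₀ ≠ 0) :
    ∃ φ : ℝ, HasSum (fun k : ℤ => p k * Real.exp (θ / 2 * k)) φ ∧ φ < 1 := by
  have hsq : ∀ k : ℤ, Real.exp (θ * k) = Real.exp (θ / 2 * k) ^ 2 := fun k => by
    rw [← Real.exp_nat_mul]; congr 1; push_cast; ring
  have hle : ∀ k : ℤ, p k * Real.exp (θ / 2 * k) ≤
      2⁻¹ * (p k + p k * Real.exp (θ * k)) := by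
    intro k
    rw [hsq]
    have := mul_nonneg (hp0 k) (sq_nonneg (Real.exp (θ / 2 * k) - 1))
    linarith
  have hs2 : Summable fun k : ℤ => 2⁻¹ * (p k + p k * Real.exp (θ * k)) :=
    (hps.add ha.summable).mul_left _
  have hs : Summable fun k : ℤ => p k * Real.exp (θ / 2 * k) :=
    Summable.of_nonneg_of_le (fun k => mul_nonneg (hp0 k) (Real.exp_pos _).le) hle hs2
  refine ⟨_, hs.hasSum, ?_⟩
  have hlt : ∑' k : ℤ, p k * Real.exp (θ / 2 * k) <
      ∑' k : ℤ, 2⁻¹ * (p k + p k * Real.exp (θ * k)) := by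
    refine Summable.tsum_lt_tsum (i := k₀) hle ?_ hs hs2
    have hne : Real.exp (θ / 2 * k₀) - 1 ≠ 0 := by
      have : (k₀ : ℝ) ≠ 0 := by exact_mod_cast hk₀
      simp [sub_eq_zero, hθ.ne', this]
    rw [hsq]
    have := mul_pos ((hp0 k₀).lt_of_ne' hpk₀) (pow_pos (abs_pos.2 hne) 2)
    rw [sq_abs] at this
    linarith
  rw [tsum_mul_left, hps.tsum_add ha.summable, ha.tsum_eq] at hlt
  linarith

/-- Implicit renewal on a lattice: `t` is a tail function, and `s` is the tail after
multiplication by an independent factor whose logarithm has the law `p`. -/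
theorem exists_tendsto_tilted_tail {t s : ℤ → ℝ} (hp0 : ∀ k, 0 ≤ p k) (hθ : 0 < θ)
    (hps : Summable p) (hp1 : ∑' k, p k ≤ 1)
    (ha : HasSum (fun k : ℤ => p k * Real.exp (θ * k)) 1)
    (hlog : Summable fun k : ℤ => p k * Real.exp (θ * k) * max (k : ℝ) 0)
    (hap : ∀ d : ℕ, (∀ k, p k ≠ 0 → (d : ℤ) ∣ k) → d = 1)
    (ht0 : ∀ j, 0 ≤ t j) (ht1 : ∀ j, t j ≤ 1) (ht : Tendsto t atTop (𝓝 0))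
    (hs : ∀ j, HasSum (fun i => p i * t (j - i)) (s j))
    (hg : Summable fun j : ℤ => Real.exp (θ * j) * |t j - s j|) :
    ∃ c, Tendsto (fun j : ℤ => Real.exp (θ * j) * t j) atTop (𝓝 c) := by
  obtain ⟨k₀, hpk₀, hk₀⟩ : ∃ k, p k ≠ 0 ∧ k ≠ 0 := by
    by_contra! h
    have := hap 2 fun k hk => by simp [h k hk]
    omega
  have habs := summable_tilted_abs hp0 hθ hps hlog
  obtain ⟨φ, hφ, hφ1⟩ := exists_hasSum_half_tilt_lt_one hp0 hθ hps hp1 ha hk₀ hpk₀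
  have ha0 : ∀ k : ℤ, 0 ≤ p k * Real.exp (θ * k) := fun k =>
    mul_nonneg (hp0 k) (Real.exp_pos _).le
  have hφ0 : 0 ≤ φ := hφ.nonneg fun k => mul_nonneg (hp0 k) (Real.exp_pos _).le
  have hf0 : ∀ j : ℤ, 0 ≤ Real.exp (θ * j) * t j := fun j =>
    mul_nonneg (Real.exp_pos _).le (ht0 j)
  have htilt : ∀ j : ℤ, HasSum (fun i : ℤ => p i * Real.exp (θ * i) *
      (Real.exp (θ * (j - i : ℤ)) * t (j - i))) (Real.exp (θ * j) * s j) := by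
    intro j
    refine ((hs j).mul_left (Real.exp (θ * j))).congr_fun fun i => ?_
    have : Real.exp (θ * j) = Real.exp (θ * i) * Real.exp (θ * (j - i : ℤ)) := by
      rw [← Real.exp_add]; congr 1; push_cast; ring
    rw [this]
    ring
  have hbound : ∃ B : ℝ, ∀ j : ℤ, |Real.exp (θ * j) * t j| ≤ B := by
    have key := le_of_renewal_subsolution
      (a := fun k => ENNReal.ofReal (p k * Real.exp (θ * k)))
      (f := fun j => ENNReal.ofReal (Real.exp (θ * j) * t j))
      (g := fun j => ENNReal.ofReal (Real.exp (θ * j) * |t j - s j|))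
      (u := fun j => ENNReal.ofReal (Real.exp (θ * j)))
      (v := fun j => ENNReal.ofReal (Real.exp (θ / 2 * j)))
      (φ := ENNReal.ofReal φ) ?_ (by simpa using hφ1) ?_ ?_ (by simp) (by simp) (by simp) ?_ ?_
    · set M := (1 - ENNReal.ofReal φ)⁻¹ *
        ∑' j : ℤ, ENNReal.ofReal (Real.exp (θ * j) * |t j - s j|) with hM
      have hM_top : M ≠ ∞ := by
        refine ENNReal.mul_ne_top ?_ hg.tsum_ofReal_ne_top
        rw [ENNReal.inv_ne_top]
        exact (tsub_pos_of_lt (by simpa using hφ1)).ne'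
      refine ⟨M.toReal, fun j => ?_⟩
      rw [abs_of_nonneg (hf0 j)]
      exact (ENNReal.ofReal_le_iff_le_toReal hM_top).1 (key j)
    · rw [← ENNReal.ofReal_tsum_of_nonneg ha0 ha.summable, ha.tsum_eq]
      simp
    · intro j
      rw [tsum_ofReal_mul_of_hasSum (z := (∑' k, p k) * Real.exp (θ * j)) ha0
        (fun i => (Real.exp_pos _).le)]
      · exact ENNReal.ofReal_le_ofReal (mul_le_of_le_one_left (Real.exp_pos _).le hp1)
      · refine (hps.hasSum.mul_right (Real.exp (θ * j))).congr_fun fun i => ?_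
        rw [mul_assoc, ← Real.exp_add]
        congr 2
        push_cast
        ring
    · intro j
      rw [tsum_ofReal_mul_of_hasSum (z := φ * Real.exp (θ / 2 * j)) ha0
        (fun i => (Real.exp_pos _).le), ENNReal.ofReal_mul hφ0]
      refine (hφ.mul_right (Real.exp (θ / 2 * j))).congr_fun fun i => ?_
      rw [mul_assoc, mul_assoc, ← Real.exp_add, ← Real.exp_add]
      congr 2
      push_cast
      ring
    · intro j
      rw [tsum_ofReal_mul_of_hasSum ha0 (fun i => hf0 _) (htilt j),
        ← ENNReal.ofReal_add (by positivity)
          ((htilt j).nonneg fun i => mul_nonneg (ha0 i) (hf0 _))]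
      refine ENNReal.ofReal_le_ofReal ?_
      rw [← mul_add]
      gcongr
      linarith [le_abs_self (t j - s j)]
    · intro ε hε
      obtain ⟨δ, hδ0, hδε⟩ : ∃ δ : ℝ, 0 < δ ∧ ENNReal.ofReal δ ≤ ε := by
        obtain ⟨δ, hδ0, hδε⟩ := ENNReal.lt_iff_exists_nnreal_btwn.1 hε
        exact ⟨δ, by exact_mod_cast hδ0, by simpa using hδε.le⟩
      obtain ⟨J, hJ⟩ := eventually_atTop.1 (ht.eventually (gt_mem_nhds hδ0))
      refine ⟨ENNReal.ofReal (Real.exp (θ / 2 * J)), by simp, fun j => ?_⟩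
      refine le_trans ?_ (add_le_add_left (mul_le_mul_left hδε _) _)
      rw [← ENNReal.ofReal_mul hδ0.le, ← ENNReal.ofReal_mul (Real.exp_pos _).le,
        ← ENNReal.ofReal_add (by positivity) (by positivity)]
      refine ENNReal.ofReal_le_ofReal ?_
      have hE := Real.exp_pos (θ * j)
      rcases le_total J j with h | h
      · have h1 := mul_le_mul_of_nonneg_left (hJ j h).le hE.le
        have h2 : 0 ≤ Real.exp (θ / 2 * J) * Real.exp (θ / 2 * j) := by positivity
        linarith
      · have h1 : Real.exp (θ * j) ≤ Real.exp (θ / 2 * J) * Real.exp (θ / 2 * j) := by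
          rw [← Real.exp_add]
          have : (j : ℝ) ≤ J := by exact_mod_cast h
          refine Real.exp_le_exp.2 ?_
          nlinarith
        have h2 := mul_le_mul_of_nonneg_left (ht1 j) hE.le
        have h3 : 0 ≤ δ * Real.exp (θ * j) := by positivity
        linarith
  obtain ⟨B, hB⟩ := hbound
  refine exists_tendsto_of_renewal_equation (a := fun k => p k * Real.exp (θ * k))
    (g := fun j => Real.exp (θ * j) * (t j - s j)) ha0 ha habs
    (tilted_mean_ne_zero hp0 hθ hps hp1 ha habs hk₀ hpk₀)
    (fun d hd => hap d fun k hk => hd k (mul_ne_zero hk (Real.exp_pos _).ne')) hB ?_ fun j => ?_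
  · refine Summable.of_norm_bounded hg fun j => ?_
    rw [norm_mul, Real.norm_eq_abs, Real.norm_eq_abs, Real.abs_exp]
  · rw [(htilt j).tsum_eq]
    ring

end ExponentialTilting

section LatticeValued

variable {Ω : Type*} [MeasurableSpace Ω] {P : Measure Ω} {A X : Ω → ℝ} {h : ℝ}

lemma lintegral_eq_tsum_setLIntegral (hA : Measurable A) (hh : 0 < h) (hA0 : ∀ᵐ ω ∂P, 0 ≤ A ω)
    (hlat : P {ω | A ω ≠ 0 ∧ ∀ k : ℤ, Real.log (A ω) ≠ (k : ℝ) * h} = 0)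
    {F : Ω → ℝ≥0∞} (hF : ∀ ω, A ω = 0 → F ω = 0) :
    ∫⁻ ω, F ω ∂P = ∑' k : ℤ, ∫⁻ ω in {ω | A ω = Real.exp (k * h)}, F ω ∂P := by
  have hmeas : ∀ k : ℤ, MeasurableSet {ω | A ω = Real.exp (k * h)} := fun k =>
    hA (measurableSet_singleton _)
  rw [← lintegral_iUnion hmeas]
  · rw [← lintegral_indicator (MeasurableSet.iUnion hmeas)]
    refine lintegral_congr_ae ?_
    filter_upwards [hA0, measure_eq_zero_iff_ae_notMem.1 hlat] with ω h0 hω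
    by_cases hAω : A ω = 0
    · rw [hF ω hAω]
      exact (Set.indicator_apply_eq_zero.2 fun _ => hF ω hAω).symm
    · simp only [not_and, not_forall, not_not] at hω
      obtain ⟨k, hk⟩ := hω hAω
      rw [Set.indicator_of_mem]
      refine Set.mem_iUnion.2 ⟨k, ?_⟩
      rw [Set.mem_ofPred_eq, ← hk, Real.exp_log (h0.lt_of_ne' hAω)]
  · intro i j hij
    refine Set.disjoint_left.2 fun ω hi hj => hij ?_
    have h1 : (i : ℝ) * h = j * h := Real.exp_injective (hi.symm.trans hj)
    exact_mod_cast mul_right_cancel₀ hh.ne' h1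

lemma lintegral_comp_eq_tsum (hA : Measurable A) (hh : 0 < h) (hA0 : ∀ᵐ ω ∂P, 0 ≤ A ω)
    (hlat : P {ω | A ω ≠ 0 ∧ ∀ k : ℤ, Real.log (A ω) ≠ (k : ℝ) * h} = 0)
    {F : ℝ → ℝ≥0∞} (hF : F 0 = 0) :
    ∫⁻ ω, F (A ω) ∂P = ∑' k : ℤ, P {ω | A ω = Real.exp (k * h)} * F (Real.exp (k * h)) := by
  rw [lintegral_eq_tsum_setLIntegral hA hh hA0 hlat fun ω hω => by rw [hω, hF]]
  refine tsum_congr fun k => ?_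
  have hS : MeasurableSet {ω | A ω = Real.exp (k * h)} := hA (measurableSet_singleton _)
  rw [setLIntegral_congr_fun (g := fun _ => F (Real.exp (k * h))) hS
    fun ω hω => congrArg F hω]
  rw [setLIntegral_const, mul_comm]

lemma measure_mul_gt_eq_tsum (hA : Measurable A) (hX : Measurable X) (hind : IndepFun A X P)
    (hh : 0 < h) (hA0 : ∀ᵐ ω ∂P, 0 ≤ A ω)
    (hlat : P {ω | A ω ≠ 0 ∧ ∀ k : ℤ, Real.log (A ω) ≠ (k : ℝ) * h} = 0)
    {y : ℝ} (hy : 0 < y) :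
    P {ω | A ω * X ω > y} =
      ∑' k : ℤ, P {ω | A ω = Real.exp (k * h)} * P {ω | X ω > y * Real.exp (-(k * h))} := by
  have hS : MeasurableSet {ω | A ω * X ω > y} := measurableSet_lt measurable_const (hA.mul hX)
  rw [← lintegral_indicator_one hS, lintegral_eq_tsum_setLIntegral hA hh hA0 hlat]
  · refine tsum_congr fun k => ?_
    rw [lintegral_indicator_one hS, Measure.restrict_apply hS]
    have hset : {ω | A ω * X ω > y} ∩ {ω | A ω = Real.exp (k * h)} =
        A ⁻¹' {Real.exp (k * h)} ∩ X ⁻¹' Set.Ioi (y * Real.exp (-(k * h))) := by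
      ext ω
      simp only [Set.mem_inter_iff, Set.mem_ofPred_eq, Set.mem_preimage, Set.mem_singleton_iff,
        Set.mem_Ioi]
      rw [and_comm]
      refine and_congr_right fun hω => ?_
      rw [hω, gt_iff_lt, Real.exp_neg, ← div_eq_mul_inv, div_lt_iff₀ (Real.exp_pos _), mul_comm]
    rw [hset, hind.measure_inter_preimage_eq_mul _ _ (measurableSet_singleton _)
      measurableSet_Ioi]
    rfl
  · intro ω hω
    simp [hω, hy.le]

/-- Under the moment assumptions on `A`, the tilted tail of `X` converges along each lattice
`x + hℤ` on which it satisfies the summability condition. -/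
lemma exists_tendsto_tail [IsProbabilityMeasure P] {κ : ℝ} (hA : Measurable A) (hX : Measurable X)
    (hA1 : AssumptionA1 P A κ h) (hind : IndepFun A X P) (x : ℝ)
    (hsum : Summable fun j : ℤ => Real.exp (κ * (x + j * h)) *
        |(P {ω | X ω > Real.exp (x + j * h)}).toReal -
          (P {ω | A ω * X ω > Real.exp (x + j * h)}).toReal|) :
    ∃ c, Tendsto (fun j : ℤ => Real.exp (κ * (x + j * h)) *
      (P {ω | X ω > Real.exp (x + j * h)}).toReal) atTop (𝓝 c) := by
  obtain ⟨hκ, hA0, hmom, hlogmom, hh, hlat, hspan⟩ := hA1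
  have hθ : 0 < κ * h := mul_pos hκ hh
  set p : ℤ → ℝ := fun k => (P {ω | A ω = Real.exp (k * h)}).toReal with hp
  have hp0 : ∀ k, 0 ≤ p k := fun k => ENNReal.toReal_nonneg
  have hsplit : ∀ j : ℤ, Real.exp (κ * (x + j * h)) =
      Real.exp (κ * x) * Real.exp (κ * h * j) := fun j => by
    rw [← Real.exp_add]; congr 1; ring
  have hpow : ∀ k : ℤ, Real.exp (k * h) ^ κ = Real.exp (κ * h * k) := fun k => by
    rw [← Real.exp_mul]; congr 1; ring
  have hpE : ∑' k : ℤ, P {ω | A ω = Real.exp (k * h)} ≤ 1 := by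
    have := lintegral_comp_eq_tsum (F := Set.indicator {0}ᶜ 1) hA hh hA0 hlat (by simp)
    simp only [Set.indicator_of_mem (show Real.exp _ ∈ ({0}ᶜ : Set ℝ) from (Real.exp_pos _).ne'),
      Pi.one_apply, mul_one] at this
    rw [← this]
    calc _ ≤ ∫⁻ _, 1 ∂P := lintegral_mono fun ω =>
            Set.indicator_le_self' (f := 1) (fun _ _ => zero_le_one) (A ω)
      _ = 1 := by simp
  have hpE_top : ∑' k : ℤ, P {ω | A ω = Real.exp (k * h)} ≠ ∞ := ne_top_of_le_ne_top (by simp) hpE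
  have hps : Summable p := ENNReal.summable_toReal hpE_top
  have hp1 : ∑' k, p k ≤ 1 := by
    rw [hp, ← ENNReal.tsum_toReal_eq fun k => measure_ne_top _ _]
    exact ENNReal.toReal_le_of_le_ofReal zero_le_one (by simpa using hpE)
  have ha : HasSum (fun k : ℤ => p k * Real.exp (κ * h * k)) 1 := by
    have hE := lintegral_comp_eq_tsum (F := fun y => ENNReal.ofReal (y ^ κ)) hA hh hA0 hlat
      (by simp [hκ.ne'])
    have hint : Integrable (fun ω => A ω ^ κ) P := by
      by_contra hn
      rw [integral_undef hn] at hmom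
      exact zero_ne_one hmom
    rw [← ofReal_integral_eq_lintegral_ofReal hint
      (hA0.mono fun ω hω => Real.rpow_nonneg hω κ), hmom, ENNReal.ofReal_one] at hE
    have hs := ENNReal.hasSum_toReal (hE ▸ ENNReal.one_ne_top)
    rw [← ENNReal.tsum_toReal_eq fun k =>
      ENNReal.mul_ne_top (measure_ne_top _ _) ENNReal.ofReal_ne_top, ← hE,
      ENNReal.toReal_one] at hs
    refine hs.congr_fun fun k => ?_
    rw [ENNReal.toReal_mul, ENNReal.toReal_ofReal (by positivity), hpow]
  have hlog : Summable fun k : ℤ => p k * Real.exp (κ * h * k) * max (k : ℝ) 0 := by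
    have hE := lintegral_comp_eq_tsum
      (F := fun y => ENNReal.ofReal (y ^ κ * max (Real.log y) 0)) hA hh hA0 hlat (by simp)
    refine ((ENNReal.summable_toReal (hE ▸ hlogmom.ne)).mul_right h⁻¹).congr fun k => ?_
    rw [ENNReal.toReal_mul, ENNReal.toReal_ofReal (by positivity), hpow, Real.log_exp,
      show max ((k : ℝ) * h) 0 = max (k : ℝ) 0 * h by rw [max_mul_of_nonneg _ _ hh.le, zero_mul]]
    simp only [hp]
    field_simp
  have hap : ∀ d : ℕ, (∀ k, p k ≠ 0 → (d : ℤ) ∣ k) → d = 1 := by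
    have hle : ∀ d : ℕ, 0 < d → (∀ k, p k ≠ 0 → (d : ℤ) ∣ k) → d ≤ 1 := by
      intro d hd hdiv
      have hnull : P {ω | A ω ≠ 0 ∧ ∀ k : ℤ, Real.log (A ω) ≠ (k : ℝ) * (d * h)} = 0 := by
        rw [measure_eq_zero_iff_ae_notMem]
        have hnull' : ∀ᵐ ω ∂P, ∀ k : ℤ, p k = 0 → A ω ≠ Real.exp (k * h) := by
          rw [ae_all_iff]
          intro k
          by_cases hk : p k = 0
          · have h0 : P {ω | A ω = Real.exp (k * h)} = 0 :=
              ((ENNReal.toReal_eq_zero_iff _).1 hk).resolve_right (measure_ne_top _ _)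
            filter_upwards [measure_eq_zero_iff_ae_notMem.1 h0] with ω hω _ using hω
          · exact Filter.Eventually.of_forall fun ω h0 => absurd h0 hk
        filter_upwards [hA0, measure_eq_zero_iff_ae_notMem.1 hlat, hnull'] with ω h0 h1 h2
        rintro ⟨hne, hall⟩
        simp only [not_and, not_forall, not_not] at h1
        obtain ⟨k, hk⟩ := h1 hne
        have hpk : p k ≠ 0 := fun hpk => h2 k hpk (by
          rw [← hk, Real.exp_log (h0.lt_of_ne' hne)])
        obtain ⟨l, rfl⟩ := hdiv k hpk
        refine hall l ?_
        rw [hk]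
        push_cast
        ring
      have h1 := hspan (d * h) (by positivity) hnull
      have h2 : (d : ℝ) ≤ 1 := le_of_mul_le_mul_right (by linarith) hh
      exact_mod_cast h2
    intro d hd
    rcases Nat.eq_zero_or_pos d with rfl | hd0
    · have := hle 2 two_pos fun k hk => by
        simp [zero_dvd_iff.1 (show (0 : ℤ) ∣ k from hd k hk)]
      omega
    · exact le_antisymm (hle d hd0 hd) hd0
  have hlattice : Tendsto (fun j : ℤ => Real.exp (x + j * h)) atTop atTop :=
    Real.tendsto_exp_atTop.comp (tendsto_atTop_add_const_left _ _
      (tendsto_intCast_atTop_atTop.atTop_mul_const hh))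
  have ht : Tendsto (fun j : ℤ => (P {ω | X ω > Real.exp (x + j * h)}).toReal) atTop (𝓝 0) := by
    have : IsProbabilityMeasure (P.map X) := Measure.isProbabilityMeasure_map hX.aemeasurable
    have h1 := ((tendsto_cdf_atTop (P.map X)).comp hlattice).const_sub 1
    rw [sub_self] at h1
    refine h1.congr fun j => ?_
    have h2 : {ω | X ω > Real.exp (x + j * h)} = (X ⁻¹' Set.Iic (Real.exp (x + j * h)))ᶜ := by
      ext ω; simp
    have h3 := probReal_compl_eq_one_sub (μ := P)
      (hX (measurableSet_Iic (a := Real.exp (x + j * h))))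
    rw [h2, Function.comp_apply, cdf_eq_real, map_measureReal_apply hX measurableSet_Iic, ← h3]
    rfl
  have hs : ∀ j : ℤ, HasSum
      (fun i : ℤ => p i * (P {ω | X ω > Real.exp (x + (j - i : ℤ) * h)}).toReal)
      (P {ω | A ω * X ω > Real.exp (x + j * h)}).toReal := by
    intro j
    have hE := measure_mul_gt_eq_tsum hA hX hind hh hA0 hlat (Real.exp_pos (x + j * h))
    have h1 := ENNReal.hasSum_toReal (hE ▸ measure_ne_top _ _)
    rw [← ENNReal.tsum_toReal_eq fun k =>
      ENNReal.mul_ne_top (measure_ne_top _ _) (measure_ne_top _ _), ← hE] at h1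
    refine h1.congr_fun fun i => ?_
    rw [ENNReal.toReal_mul, ← Real.exp_add,
      show x + ((j - i : ℤ) : ℝ) * h = x + j * h + -(i * h) by push_cast; ring]
  obtain ⟨c, hc⟩ := exists_tendsto_tilted_tail
    (t := fun j => (P {ω | X ω > Real.exp (x + j * h)}).toReal)
    (s := fun j => (P {ω | A ω * X ω > Real.exp (x + j * h)}).toReal)
    hp0 hθ hps hp1 ha hlog hap (fun j => ENNReal.toReal_nonneg) (fun j => measureReal_le_one)
    ht hs ((hsum.mul_left (Real.exp (κ * x))⁻¹).congr fun j => by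
      rw [hsplit, mul_assoc, inv_mul_cancel_left₀ (Real.exp_pos _).ne'])
  refine ⟨Real.exp (κ * x) * c, (hc.const_mul _).congr fun j => ?_⟩
  rw [hsplit, ← mul_assoc]

end LatticeValued

/-- Theorem 1, second part: under (A1), the integrability condition and the stronger
summability condition, the limit `x^κ e^{κnh} P(X > x e^{nh}) → q(x)` holds for EVERY `x > 0`. -/
theorem stmt1 {Ω : Type*} [MeasurableSpace Ω] (P : Measure Ω) [IsProbabilityMeasure P]
    (A X : Ω → ℝ) (hAmeas : Measurable A) (hXmeas : Measurable X)
    (κ h : ℝ) (hA1 : AssumptionA1 P A κ h)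
    (hindep : IndepFun A X P)
    (hint : IntegrableOn
      (fun y : ℝ => y ^ (κ - 1) *
        |(P {ω | X ω > y}).toReal - (P {ω | A ω * X ω > y}).toReal|)
      (Set.Ioi (0 : ℝ)))
    (hsum : ∀ x : ℝ, Summable (fun j : ℤ =>
      Real.exp (κ * (x + j * h)) *
        |(P {ω | X ω > Real.exp (x + j * h)}).toReal -
          (P {ω | A ω * X ω > Real.exp (x + j * h)}).toReal|)) :
    ∃ q : ℝ → ℝ, MemQ κ h q ∧
      ∀ x : ℝ, 0 < x →
        Tendsto (fun n : ℕ =>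
            x ^ κ * Real.exp (κ * (n * h)) * (P {ω | X ω > x * Real.exp (n * h)}).toReal)
          atTop (𝓝 (q x)) := by
  have hlim : ∀ x : ℝ, ∃ c, 0 < x → Tendsto (fun n : ℕ =>
      x ^ κ * Real.exp (κ * (n * h)) * (P {ω | X ω > x * Real.exp (n * h)}).toReal)
      atTop (𝓝 c) := by
    intro x
    obtain ⟨c, hc⟩ :=
      exists_tendsto_tail hAmeas hXmeas hA1 hindep (Real.log x) (hsum (Real.log x))
    refine ⟨c, fun hx => (hc.comp tendsto_natCast_atTop_atTop).congr fun n => ?_⟩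
    simp only [Function.comp_apply, Int.cast_natCast]
    rw [mul_add, Real.exp_add, Real.exp_add, Real.exp_log hx, Real.rpow_def_of_pos hx,
      mul_comm κ (Real.log x)]
  choose q hq using hlim
  refine ⟨q, ⟨fun x hx => ?_, fun x hx y hy hxy => ?_, fun x hx => ?_⟩, hq⟩
  · exact ge_of_tendsto' (hq x hx) fun n => by positivity
  · have hscale : ∀ z : ℝ, 0 < z → Tendsto (fun n : ℕ => Real.exp (κ * (n * h)) *
        (P {ω | X ω > z * Real.exp (n * h)}).toReal) atTop (𝓝 (z ^ (-κ) * q z)) := by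
      intro z hz
      refine ((hq z hz).const_mul (z ^ (-κ))).congr fun n => ?_
      rw [mul_assoc, ← mul_assoc, ← Real.rpow_add hz, neg_add_cancel, Real.rpow_zero, one_mul]
    refine le_of_tendsto_of_tendsto' (hscale y hy) (hscale x hx) fun n => ?_
    gcongr
    · exact measure_ne_top _ _
  · have hshift := (hq x hx).comp (tendsto_add_atTop_nat 1)
    refine tendsto_nhds_unique (hq _ (mul_pos hx (Real.exp_pos h))) (hshift.congr fun n => ?_)
    simp only [Function.comp_apply]
    have h1 : ((n + 1 : ℕ) : ℝ) * h = h + n * h := by push_cast; ring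
    rw [h1, Real.mul_rpow hx.le (Real.exp_pos h).le, ← Real.exp_mul, mul_add, Real.exp_add,
      Real.exp_add, mul_comm h κ]
    simp only [mul_assoc]
end
end
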